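/- Let d ∈ ℕ, l ∈ ℤ_+^d, 1 < p < ∞, and set p* = min(2, p). There exists a constant c > 0 depending only on d, l, p such that for every f ∈ L₁(I^d) and every k ∈ ℤ_+^d: ‖E_k^{d,l} f‖_{L_p(I^d)} ≤ c (Σ_{κ ∈ ℤ_+^d, κ ≤ k} ‖𝓔_κ^{d,l} f‖_{L_p(I^d)}^{p*})^{1/p*}. -/

import Mathlib

open MeasureTheory ENNReal

noncomputable section

/-- The open unit cube `I^d = (0,1)^d`. -/
def unitCube (d : ℕ) : Set (Fin d → ℝ) := Set.univ.pi fun _ => Set.Ioo (0:ℝ) 1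

/-- Lebesgue measure restricted to the unit cube. -/
def cubeMeasure (d : ℕ) : Measure (Fin d → ℝ) := volume.restrict (unitCube d)

/-- The open dyadic cube `Q_{κ,ν} = ∏_j (2^{-κ_j} ν_j, 2^{-κ_j} ν_j + 2^{-κ_j})`. -/
def dyadicCube (d : ℕ) (κ ν : Fin d → ℤ) : Set (Fin d → ℝ) :=
  Set.univ.pi fun j =>
    Set.Ioo ((2:ℝ) ^ (-(κ j)) * (ν j : ℝ)) ((2:ℝ) ^ (-(κ j)) * (ν j : ℝ) + (2:ℝ) ^ (-(κ j)))

/-- `ν` is an admissible multi-index at level `κ`, i.e. `0 ≤ ν_j < 2^{κ_j}`. -/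
def validIdx (d : ℕ) (κ : Fin d → ℕ) (ν : Fin d → ℤ) : Prop :=
  ∀ j, 0 ≤ ν j ∧ ν j < 2 ^ κ j

/-- A polynomial has coordinate degrees at most `l`. -/
def degLE (d : ℕ) (l : Fin d → ℕ) (P : MvPolynomial (Fin d) ℝ) : Prop :=
  ∀ j, P.degreeOf j ≤ l j

/-- `f` coincides on each dyadic cube of level `κ` inside `I^d` with a polynomial of
coordinate degrees at most `l`: membership in `𝒫_κ^{d,l}`. -/
def IsPiecewisePoly (d : ℕ) (l κ : Fin d → ℕ) (f : (Fin d → ℝ) → ℝ) : Prop :=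
  ∀ ν : Fin d → ℤ, validIdx d κ ν →
    ∃ P : MvPolynomial (Fin d) ℝ, degLE d l P ∧
      ∀ x ∈ dyadicCube d (fun j => (κ j : ℤ)) ν, f x = MvPolynomial.eval x P

/-- `E` is the family of local `L₂`-projection operators `E_κ^{d,l}`:
each `E κ` is linear, takes values in `𝒫_κ^{d,l}`, and on each dyadic cube of level `κ`
the image has the same integrals against polynomials of coordinate degrees `≤ l`
as the original (integrable) function. -/
def IsProjFamily (d : ℕ) (l : Fin d → ℕ)
    (E : (Fin d → ℕ) → ((Fin d → ℝ) → ℝ) → ((Fin d → ℝ) → ℝ)) : Prop :=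
  ∀ κ : Fin d → ℕ,
    (∀ f g, E κ (f + g) = E κ f + E κ g) ∧
    (∀ (c : ℝ) (f), E κ (c • f) = c • E κ f) ∧
    (∀ f, IsPiecewisePoly d l κ (E κ f)) ∧
    (∀ f, IntegrableOn f (unitCube d) → ∀ ν, validIdx d κ ν →
      ∀ P : MvPolynomial (Fin d) ℝ, degLE d l P →
        ∫ x in dyadicCube d (fun j => (κ j : ℤ)) ν, E κ f x * MvPolynomial.eval x P =
        ∫ x in dyadicCube d (fun j => (κ j : ℤ)) ν, f x * MvPolynomial.eval x P)

/-- `s(κ) = {j : κ_j ≠ 0}`. -/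
def sSet (d : ℕ) (κ : Fin d → ℕ) : Finset (Fin d) := Finset.univ.filter fun j => κ j ≠ 0

/-- The operators `𝓔_κ^{d,l} = Σ_{ε ∈ {0,1}^d, s(ε) ⊆ s(κ)} (−1)^{|ε|} E_{κ−ε}^{d,l}`. -/
def calE (d : ℕ) (E : (Fin d → ℕ) → ((Fin d → ℝ) → ℝ) → ((Fin d → ℝ) → ℝ))
    (κ : Fin d → ℕ) (f : (Fin d → ℝ) → ℝ) : (Fin d → ℝ) → ℝ :=
  fun x => ∑ S ∈ (sSet d κ).powerset,
    (-1 : ℝ) ^ S.card * E (fun j => κ j - (if j ∈ S then 1 else 0)) f x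

/-- The finite set of multi-indices `{κ ∈ ℤ_+^d : κ ≤ k}`. -/
def rect (d : ℕ) (k : Fin d → ℕ) : Finset (Fin d → ℕ) :=
  Fintype.piFinset fun j => Finset.range (k j + 1)

/-- The signed power `|x|^(p-2) x`, which is the derivative of `|x|^p / p`. -/
noncomputable def signedPow (p x : ℝ) : ℝ := |x| ^ (p - 2) * x

theorem signedPow_of_nonneg {p x : ℝ} (hp : 1 < p) (hx : 0 ≤ x) :
    signedPow p x = x ^ (p - 1) := by
  rcases hx.eq_or_lt with rfl | hx
  · simp [signedPow, Real.zero_rpow (by linarith : p - 1 ≠ 0)]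
  · rw [signedPow, abs_of_pos hx, ← Real.rpow_add_one hx.ne']
    ring_nf

theorem signedPow_neg (p x : ℝ) : signedPow p (-x) = -signedPow p x := by
  simp [signedPow]

theorem signedPow_zero (p : ℝ) : signedPow p 0 = 0 := by simp [signedPow]

theorem abs_signedPow {p : ℝ} (hp : 1 < p) (x : ℝ) : |signedPow p x| = |x| ^ (p - 1) := by
  have h : |signedPow p x| = signedPow p |x| := by
    rw [signedPow, signedPow, abs_mul, abs_abs, abs_of_nonneg (by positivity)]
  rw [h, signedPow_of_nonneg hp (abs_nonneg x)]

theorem signedPow_mul_self {p : ℝ} (hp : 1 < p) (x : ℝ) : signedPow p x * x = |x| ^ p := by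
  rcases eq_or_ne x 0 with rfl | hx
  · simp [signedPow, Real.zero_rpow (by linarith : p ≠ 0)]
  · rw [signedPow, mul_assoc, ← abs_mul_abs_self x, ← mul_assoc,
      ← Real.rpow_add_one (abs_pos.2 hx).ne', ← Real.rpow_add_one (abs_pos.2 hx).ne']
    ring_nf

theorem abs_signedPow_sub_le {p : ℝ} (hp : 1 < p) (M : ℝ → ℝ → ℝ)
    (hsymm : ∀ x y, M x y = M y x) (hneg : ∀ x y, M (-x) (-y) = M x y)
    (hsub : ∀ u v, 0 ≤ v → v ≤ u → u ^ (p - 1) - v ^ (p - 1) ≤ M u v)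
    (hadd : ∀ u v, 0 ≤ u → 0 ≤ v → u ^ (p - 1) + v ^ (p - 1) ≤ M u (-v)) (x y : ℝ) :
    |signedPow p x - signedPow p y| ≤ M x y := by
  have key : ∀ u v : ℝ, 0 ≤ v → v ≤ u → |signedPow p u - signedPow p v| ≤ M u v := by
    intro u v hv huv
    rw [signedPow_of_nonneg hp hv, signedPow_of_nonneg hp (hv.trans huv), abs_of_nonneg]
    · exact hsub u v hv huv
    · exact sub_nonneg.2 (Real.rpow_le_rpow hv huv (by linarith))
  have key' : ∀ u v : ℝ, 0 ≤ v → 0 ≤ u → |signedPow p u - signedPow p v| ≤ M u v := by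
    intro u v hv hu
    rcases le_total u v with h | h
    · rw [abs_sub_comm, hsymm]; exact key v u hu h
    · exact key u v hv h
  have key2 : ∀ u v : ℝ, 0 ≤ u → 0 ≤ v → |signedPow p u - signedPow p (-v)| ≤ M u (-v) := by
    intro u v hu hv
    rw [signedPow_neg, sub_neg_eq_add, signedPow_of_nonneg hp hv, signedPow_of_nonneg hp hu,
      abs_of_nonneg (by positivity)]
    exact hadd u v hu hv
  rcases le_total 0 x with hx | hx <;> rcases le_total 0 y with hy | hy
  · exact key' x y hy hx
  · simpa using key2 x (-y) hx (by linarith)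
  · rw [abs_sub_comm, hsymm]
    simpa using key2 y (-x) hy (by linarith)
  · have := key' (-x) (-y) (by linarith) (by linarith)
    rw [signedPow_neg, signedPow_neg, hneg] at this
    rwa [abs_sub_comm, ← neg_sub_neg]

theorem abs_rpow_add_le_tangent {p : ℝ} (hp : 1 < p) (a b : ℝ) :
    |a + b| ^ p ≤ |a| ^ p + p * signedPow p (a + b) * b := by
  have hy := Real.young_inequality_of_nonneg (abs_nonneg (signedPow p (a + b))) (abs_nonneg a)
    (Real.HolderConjugate.conjExponent hp).symm
  rw [abs_signedPow hp, ← Real.rpow_mul (abs_nonneg _)] at hy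
  have h1 : (p - 1) * p.conjExponent = p := by
    rw [Real.conjExponent]; field_simp [(by linarith : p - 1 ≠ 0)]
  rw [h1] at hy
  have h2 : |a + b| ^ p / p.conjExponent = (p - 1) / p * |a + b| ^ p := by
    rw [Real.conjExponent]; field_simp
  rw [h2] at hy
  have h3 : signedPow p (a + b) * a ≤ |a + b| ^ (p - 1) * |a| := by
    rw [← abs_signedPow hp, ← abs_mul]; exact le_abs_self _
  have h4 := signedPow_mul_self hp (a + b)
  have h5 : p * (signedPow p (a + b) * a) ≤ (p - 1) * |a + b| ^ p + |a| ^ p := by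
    calc _ ≤ p * ((p - 1) / p * |a + b| ^ p + |a| ^ p / p) := by
          gcongr; exact h3.trans hy
      _ = _ := by field_simp
  nlinarith

theorem abs_rpow_add_le_of_le_two {p : ℝ} (hp : 1 < p) (hp2 : p ≤ 2) (a b : ℝ) :
    |a + b| ^ p ≤ |a| ^ p + p * (signedPow p a * b) + 2 * p * |b| ^ p := by
  have h1 := abs_rpow_add_le_tangent hp a b
  have h2 := abs_signedPow_sub_le hp (fun x y => 2 * |x - y| ^ (p - 1))
    (fun x y => by rw [abs_sub_comm]) (fun x y => by rw [abs_sub_comm]; ring_nf)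
    (fun u v hv huv => by
      have := Real.rpow_add_le_add_rpow hv (sub_nonneg.2 huv) (p := p - 1)
        (by linarith) (by linarith)
      rw [abs_of_nonneg (sub_nonneg.2 huv)]
      have h0 := Real.rpow_nonneg (sub_nonneg.2 huv) (p - 1)
      rw [add_sub_cancel] at this
      linarith)
    (fun u v hu hv => by
      rw [sub_neg_eq_add, abs_of_nonneg (by positivity)]
      have h1 := Real.rpow_le_rpow hu (by linarith : u ≤ u + v) (by linarith : 0 ≤ p - 1)
      have h2 := Real.rpow_le_rpow hv (by linarith : v ≤ u + v) (by linarith : 0 ≤ p - 1)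
      linarith) (a + b) a
  rw [add_sub_cancel_left] at h2
  have h3 : (signedPow p (a + b) - signedPow p a) * b ≤ 2 * |b| ^ p := by
    calc _ ≤ |signedPow p (a + b) - signedPow p a| * |b| := by
          rw [← abs_mul]; exact le_abs_self _
      _ ≤ 2 * |b| ^ (p - 1) * |b| := by gcongr
      _ = 2 * |b| ^ p := by
        rcases eq_or_ne b 0 with rfl | hb
        · simp [Real.zero_rpow (by linarith : p ≠ 0)]
        · rw [mul_assoc, ← Real.rpow_add_one (abs_pos.2 hb).ne']; ring_nf
  nlinarith

theorem abs_rpow_add_le_of_two_le {p : ℝ} (hp2 : 2 ≤ p) (a b : ℝ) :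
    |a + b| ^ p ≤ |a| ^ p + p * (signedPow p a * b)
      + p ^ 2 * 4 ^ p * (|a| ^ (p - 2) * |b| ^ 2 + |b| ^ p) := by
  have hp : 1 < p := by linarith
  have h1 := abs_rpow_add_le_tangent hp a b
  have h2 := abs_signedPow_sub_le hp (fun x y => p * (|x - y| * (|x| + |y|) ^ (p - 2)))
    (fun x y => by rw [abs_sub_comm, add_comm])
    (fun x y => by rw [abs_sub_comm, abs_neg, abs_neg]; ring_nf)
    (fun u v hv huv => by
      have hu : 0 ≤ u := hv.trans huv
      rw [abs_of_nonneg (sub_nonneg.2 huv), abs_of_nonneg hv, abs_of_nonneg hu]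
      rcases hu.eq_or_lt with rfl | hu'
      · have : v = 0 := le_antisymm huv hv
        subst this; simp
      have hb := one_add_mul_self_le_rpow_one_add (s := (v - u) / u) (p := p - 1)
        (by rw [le_div_iff₀ hu']; linarith) (by linarith)
      have e : 1 + (v - u) / u = v / u := by field_simp; ring
      rw [e, Real.div_rpow hv hu, le_div_iff₀ (by positivity)] at hb
      have e2 : u ^ (p - 1) = u ^ (p - 2) * u := by
        rw [← Real.rpow_add_one hu'.ne']; ring_nf
      have e3 : (1 + (p - 1) * ((v - u) / u)) * u ^ (p - 1)
          = u ^ (p - 1) - (p - 1) * ((u - v) * u ^ (p - 2)) := by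
        rw [e2]; field_simp; ring
      rw [e3] at hb
      have h3 : u ^ (p - 2) ≤ (u + v) ^ (p - 2) :=
        Real.rpow_le_rpow hu (by linarith) (by linarith)
      have h4 : (u - v) * u ^ (p - 2) ≤ (u - v) * (u + v) ^ (p - 2) :=
        mul_le_mul_of_nonneg_left h3 (by linarith)
      have h5 : 0 ≤ (u - v) * u ^ (p - 2) := mul_nonneg (by linarith) (by positivity)
      nlinarith)
    (fun u v hu hv => by
      rw [sub_neg_eq_add, abs_neg, abs_of_nonneg (add_nonneg hu hv), abs_of_nonneg hu,
        abs_of_nonneg hv]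
      rcases (add_nonneg hu hv).eq_or_lt with h | h
      · have : u = 0 := by linarith
        have : v = 0 := by linarith
        subst_vars; simp [Real.zero_rpow (by linarith : p - 1 ≠ 0)]
      rw [mul_comm (u + v), ← Real.rpow_add_one h.ne']
      have h1 := Real.rpow_le_rpow hu (by linarith : u ≤ u + v) (by linarith : 0 ≤ p - 1)
      have h2 := Real.rpow_le_rpow hv (by linarith : v ≤ u + v) (by linarith : 0 ≤ p - 1)
      have e : p - 2 + 1 = p - 1 := by ring
      rw [e]
      nlinarith [Real.rpow_nonneg h.le (p - 1)]) (a + b) a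
  rw [add_sub_cancel_left] at h2
  have h4 : (|a + b| + |a|) ^ (p - 2) ≤ 4 ^ p * (|a| ^ (p - 2) + |b| ^ (p - 2)) := by
    have hm : |a + b| + |a| ≤ 4 * max |a| |b| := by
      have := abs_add_le a b
      have := le_max_left |a| |b|
      have := le_max_right |a| |b|
      have := abs_nonneg a
      linarith [abs_nonneg b]
    calc _ ≤ (4 * max |a| |b|) ^ (p - 2) :=
          Real.rpow_le_rpow (by positivity) hm (by linarith)
      _ = 4 ^ (p - 2) * (max |a| |b|) ^ (p - 2) := Real.mul_rpow (by norm_num) (by positivity)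
      _ ≤ _ := by
        gcongr
        · norm_num
        · linarith
        · rcases max_choice |a| |b| with h | h <;> rw [h]
          · linarith [Real.rpow_nonneg (abs_nonneg b) (p - 2)]
          · linarith [Real.rpow_nonneg (abs_nonneg a) (p - 2)]
  have h5 : |b| ^ (p - 2) * |b| ^ 2 = |b| ^ p := by
    rw [← Real.rpow_natCast, ← Real.rpow_add_of_nonneg (abs_nonneg b) (by linarith) (by norm_num)]
    norm_num
  have h3 : (signedPow p (a + b) - signedPow p a) * b
      ≤ p * (4 ^ p * (|a| ^ (p - 2) * |b| ^ 2 + |b| ^ p)) := by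
    calc _ ≤ |signedPow p (a + b) - signedPow p a| * |b| := by
          rw [← abs_mul]; exact le_abs_self _
      _ ≤ p * (|b| * (|a + b| + |a|) ^ (p - 2)) * |b| := by gcongr
      _ ≤ p * (|b| * (4 ^ p * (|a| ^ (p - 2) + |b| ^ (p - 2)))) * |b| := by gcongr
      _ = p * (4 ^ p * (|a| ^ (p - 2) * |b| ^ 2 + |b| ^ (p - 2) * |b| ^ 2)) := by ring
      _ = _ := by rw [h5]
  nlinarith

section MartingaleType

variable {Ω : Type*} [MeasurableSpace Ω] {μ : Measure Ω} {p : ℝ}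

theorem measurable_signedPow (p : ℝ) : Measurable (signedPow p) := by
  unfold signedPow; fun_prop

theorem MeasureTheory.MemLp.integrable_abs_rpow (hp : 1 < p) {f : Ω → ℝ}
    (hf : MemLp f (ENNReal.ofReal p) μ) : Integrable (fun x => |f x| ^ p) μ := by
  have := hf.integrable_norm_rpow (by simp; linarith) ENNReal.ofReal_ne_top
  rwa [ENNReal.toReal_ofReal (by linarith)] at this

theorem rpow_mul_rpow_le_add {s t a b : ℝ} (hs : 0 ≤ s) (ht : 0 ≤ t) (ha : 0 ≤ a) (hb : 0 ≤ b) :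
    a ^ s * b ^ t ≤ a ^ (s + t) + b ^ (s + t) := by
  rw [Real.rpow_add_of_nonneg ha hs ht, Real.rpow_add_of_nonneg hb hs ht]
  rcases le_total a b with h | h
  · have h1 : a ^ s * b ^ t ≤ b ^ s * b ^ t := by gcongr
    have : 0 ≤ a ^ s * a ^ t := by positivity
    linarith
  · have h1 : a ^ s * b ^ t ≤ a ^ s * a ^ t := by gcongr
    have : 0 ≤ b ^ s * b ^ t := by positivity
    linarith

theorem MeasureTheory.MemLp.integrable_signedPow_mul (hp : 1 < p) {S D : Ω → ℝ}
    (hS : MemLp S (ENNReal.ofReal p) μ) (hD : MemLp D (ENNReal.ofReal p) μ) :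
    Integrable (fun x => signedPow p (S x) * D x) μ := by
  refine ((hS.integrable_abs_rpow hp).add (hD.integrable_abs_rpow hp)).mono' ?_ ?_
  · exact (((measurable_signedPow p).comp_aemeasurable hS.1.aemeasurable).mul
      hD.1.aemeasurable).aestronglyMeasurable
  · refine Filter.Eventually.of_forall fun x => ?_
    have := rpow_mul_rpow_le_add (by linarith : 0 ≤ p - 1) zero_le_one (abs_nonneg (S x))
      (abs_nonneg (D x))
    rw [Real.norm_eq_abs, abs_mul, abs_signedPow hp]
    simpa using this

theorem MeasureTheory.MemLp.integrable_rpow_mul_sq (hp : 2 ≤ p) {S D : Ω → ℝ}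
    (hS : MemLp S (ENNReal.ofReal p) μ) (hD : MemLp D (ENNReal.ofReal p) μ) :
    Integrable (fun x => |S x| ^ (p - 2) * |D x| ^ 2) μ := by
  have hp1 : 1 < p := by linarith
  refine ((hS.integrable_abs_rpow hp1).add (hD.integrable_abs_rpow hp1)).mono' ?_ ?_
  · have h1 := hS.1.aemeasurable
    have h2 := hD.1.aemeasurable
    exact AEMeasurable.aestronglyMeasurable (by fun_prop)
  · refine Filter.Eventually.of_forall fun x => ?_
    have := rpow_mul_rpow_le_add (by linarith : 0 ≤ p - 2) zero_le_two (abs_nonneg (S x))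
      (abs_nonneg (D x))
    rw [Real.norm_of_nonneg (by positivity)]
    simpa using this

theorem integral_rpow_mul_sq_le (hp : 2 < p) {S D : Ω → ℝ}
    (hS : MemLp S (ENNReal.ofReal p) μ) (hD : MemLp D (ENNReal.ofReal p) μ) :
    ∫ x, |S x| ^ (p - 2) * |D x| ^ 2 ∂μ
      ≤ (∫ x, |S x| ^ p ∂μ) ^ (1 - 2 / p) * (∫ x, |D x| ^ p ∂μ) ^ (2 / p) := by
  have hp1 : 1 < p := by linarith
  have hp0 : 0 < p := by linarith
  have hconj : (p / (p - 2)).HolderConjugate (p / 2) := by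
    rw [Real.holderConjugate_iff]
    refine ⟨by rw [lt_div_iff₀ (by linarith)]; linarith, ?_⟩
    rw [inv_div, inv_div]; field_simp; ring
  have e1 : p - 2 ≠ 0 := by linarith
  have h1 := hS.norm_rpow_div (ENNReal.ofReal (p - 2))
  have h2 := hD.norm_rpow_div (ENNReal.ofReal 2)
  rw [ENNReal.toReal_ofReal (by linarith), ← ENNReal.ofReal_div_of_pos (by linarith)] at h1
  rw [ENNReal.toReal_ofReal (by linarith), ← ENNReal.ofReal_div_of_pos (by linarith)] at h2
  have := integral_mul_le_Lp_mul_Lq_of_nonneg hconj (μ := μ)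
    (f := fun x => |S x| ^ (p - 2)) (g := fun x => |D x| ^ (2 : ℝ))
    (Filter.Eventually.of_forall fun x => by positivity)
    (Filter.Eventually.of_forall fun x => by positivity) h1 h2
  have e3 : ∀ y : ℝ, (|y| ^ (p - 2)) ^ (p / (p - 2)) = |y| ^ p := fun y => by
    rw [← Real.rpow_mul (abs_nonneg _)]; congr 1; field_simp
  have e4 : ∀ y : ℝ, (|y| ^ (2 : ℝ)) ^ (p / 2) = |y| ^ p := fun y => by
    rw [← Real.rpow_mul (abs_nonneg _)]; congr 1; field_simp
  simp only [e3, e4, one_div_div] at this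
  have e5 : (p - 2) / p = 1 - 2 / p := by field_simp
  rw [e5] at this
  simpa using this

theorem le_rpow_of_recursive_bound {q C : ℝ} (hq : 1 < q) (hC : 0 ≤ C) {A g : ℕ → ℝ}
    (hA0 : A 0 = 0) (hA : ∀ n, 0 ≤ A n) (hg : ∀ n, 0 ≤ g n)
    (hrec : ∀ n, A (n + 1) ≤ A n + C * (A n ^ (1 - 1 / q) * g n + g n ^ q)) (N : ℕ) :
    A N ≤ ((1 + 2 * C) * ∑ i ∈ Finset.range N, g i) ^ q := by
  set K := 1 + 2 * C with hK
  have hK1 : 1 ≤ K := by linarith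
  have hK0 : 0 < K := by linarith
  induction N with
  | zero => simp [hA0, Real.zero_rpow (by linarith : q ≠ 0)]
  | succ n ih =>
    set u := ∑ i ∈ Finset.range n, g i with hu
    have hu0 : 0 ≤ u := Finset.sum_nonneg fun i _ => hg i
    rw [Finset.sum_range_succ, ← hu]
    have h1 : u ^ q + g n ^ q ≤ (u + g n) ^ q := Real.add_rpow_le_rpow_add hu0 (hg n) hq.le
    have h2 : u ^ q + u ^ (q - 1) * g n ≤ (u + g n) ^ q := by
      have e : ∀ v : ℝ, 0 ≤ v → v ^ q = v ^ (q - 1) * v := fun v hv => by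
        rw [← Real.rpow_add_one' hv (by linarith)]; ring_nf
      rw [e u hu0, e _ (add_nonneg hu0 (hg n)), ← mul_add]
      have := Real.rpow_le_rpow hu0 (le_add_of_nonneg_right (hg n)) (by linarith : 0 ≤ q - 1)
      exact mul_le_mul_of_nonneg_right this (add_nonneg hu0 (hg n))
    have h3 : A n ^ (1 - 1 / q) ≤ K ^ (q - 1) * u ^ (q - 1) := by
      have hnn : 0 ≤ 1 - 1 / q := by
        rw [sub_nonneg, div_le_one (by linarith)]; exact hq.le
      calc _ ≤ ((K * u) ^ q) ^ (1 - 1 / q) := Real.rpow_le_rpow (hA n) ih hnn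
        _ = (K * u) ^ (q - 1) := by
          rw [← Real.rpow_mul (by positivity)]; congr 1; field_simp
        _ = _ := Real.mul_rpow hK0.le hu0
    have h4 : K ^ q = K ^ (q - 1) * K := by
      rw [← Real.rpow_add_one hK0.ne']; ring_nf
    have h5 : 1 ≤ K ^ (q - 1) := Real.one_le_rpow hK1 (by linarith)
    have hgq : 0 ≤ g n ^ q := Real.rpow_nonneg (hg n) q
    have hug : 0 ≤ u ^ (q - 1) * g n := mul_nonneg (Real.rpow_nonneg hu0 _) (hg n)
    rw [Real.mul_rpow hK0.le hu0] at ih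
    rw [Real.mul_rpow hK0.le (add_nonneg hu0 (hg n))]
    have h6 : A n ^ (1 - 1 / q) * g n ≤ K ^ (q - 1) * (u ^ (q - 1) * g n) := by
      rw [← mul_assoc]; exact mul_le_mul_of_nonneg_right h3 (hg n)
    calc A (n + 1) ≤ A n + C * (A n ^ (1 - 1 / q) * g n + g n ^ q) := hrec n
      _ ≤ K ^ q * u ^ q + C * (K ^ (q - 1) * (u ^ (q - 1) * g n) + K ^ (q - 1) * g n ^ q) := by
        gcongr
        exact le_mul_of_one_le_left hgq h5
      _ = K ^ q * u ^ q + C * K ^ (q - 1) * (u ^ (q - 1) * g n + g n ^ q) := by ring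
      _ ≤ K ^ q * u ^ q + K ^ q / 2 * (u ^ (q - 1) * g n + g n ^ q) := by
        gcongr
        rw [h4]; nlinarith
      _ ≤ K ^ q * (u + g n) ^ q := by
        have : 0 ≤ K ^ q := by positivity
        nlinarith

theorem integral_abs_rpow_sum_le (hp : 1 < p) : ∃ K : ℝ, 0 ≤ K ∧
    ∀ {Ω : Type*} [MeasurableSpace Ω] {μ : Measure Ω} (D : ℕ → Ω → ℝ),
    (∀ n, MemLp (D n) (ENNReal.ofReal p) μ) →
    (∀ n, ∫ x, signedPow p (∑ i ∈ Finset.range n, D i x) * D n x ∂μ = 0) → ∀ N,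
    (∫ x, |∑ i ∈ Finset.range N, D i x| ^ p ∂μ) ^ (1 / p) ≤
      K * (∑ i ∈ Finset.range N, ((∫ x, |D i x| ^ p ∂μ) ^ (1 / p)) ^ min 2 p) ^ (1 / min 2 p) := by
  have hp0 : 0 < p := by linarith
  rcases le_or_gt p 2 with hp2 | hp2
  · refine ⟨(2 * p) ^ (1 / p), by positivity, fun {Ω _ μ} D hD horth N => ?_⟩
    have hS : ∀ n, MemLp (fun x => ∑ i ∈ Finset.range n, D i x) (ENNReal.ofReal p) μ :=
      fun n => memLp_finsetSum _ fun i _ => hD i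
    rw [min_eq_right hp2, ← Real.mul_rpow (by positivity)
      (Finset.sum_nonneg fun i _ => by positivity)]
    refine Real.rpow_le_rpow (by positivity) ?_ (by positivity)
    have e : ∀ i, ((∫ x, |D i x| ^ p ∂μ) ^ (1 / p)) ^ p = ∫ x, |D i x| ^ p ∂μ := fun i => by
      rw [← Real.rpow_mul (integral_nonneg fun x => by positivity)]
      field_simp; simp
    simp only [e]
    induction N with
    | zero => simp [Real.zero_rpow hp0.ne']
    | succ n ih =>
      rw [Finset.sum_range_succ (fun i => ∫ x, |D i x| ^ p ∂μ), mul_add]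
      have i1 := (hS n).integrable_abs_rpow hp
      have i2 := ((hS n).integrable_signedPow_mul hp (hD n)).const_mul p
      have i3 := ((hD n).integrable_abs_rpow hp).const_mul (2 * p)
      have i12 : Integrable (fun x => |∑ i ∈ Finset.range n, D i x| ^ p
          + p * (signedPow p (∑ i ∈ Finset.range n, D i x) * D n x)) μ := i1.add i2
      calc _ ≤ ∫ x, (|∑ i ∈ Finset.range n, D i x| ^ p
            + p * (signedPow p (∑ i ∈ Finset.range n, D i x) * D n x))
            + 2 * p * |D n x| ^ p ∂μ := by
            refine integral_mono ((hS (n + 1)).integrable_abs_rpow hp) (i12.add i3)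
              fun x => ?_
            simp only [Finset.sum_range_succ]
            exact abs_rpow_add_le_of_le_two hp hp2 _ _
        _ = ∫ x, |∑ i ∈ Finset.range n, D i x| ^ p ∂μ + 2 * p * ∫ x, |D n x| ^ p ∂μ := by
            rw [integral_add i12 i3, integral_add i1 i2, integral_const_mul,
              integral_const_mul, horth n]
            ring
        _ ≤ _ := by gcongr
  · set C := p ^ 2 * 4 ^ p with hC
    refine ⟨(1 + 2 * C) ^ (1 / 2 : ℝ), by positivity, fun {Ω _ μ} D hD horth N => ?_⟩
    have hS : ∀ n, MemLp (fun x => ∑ i ∈ Finset.range n, D i x) (ENNReal.ofReal p) μ :=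
      fun n => memLp_finsetSum _ fun i _ => hD i
    have hI : ∀ i, 0 ≤ ∫ x, |D i x| ^ p ∂μ := fun i => integral_nonneg fun x => by positivity
    rw [min_eq_left hp2.le, ← Real.mul_rpow (by positivity)
      (Finset.sum_nonneg fun i _ => Real.rpow_nonneg (Real.rpow_nonneg (hI i) _) _)]
    have key := le_rpow_of_recursive_bound (q := p / 2) (C := C)
      (A := fun n => ∫ x, |∑ i ∈ Finset.range n, D i x| ^ p ∂μ)
      (g := fun i => ((∫ x, |D i x| ^ p ∂μ) ^ (1 / p)) ^ (2 : ℝ)) (by linarith) (by positivity)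
      (by simp [Real.zero_rpow hp0.ne']) (fun n => integral_nonneg fun x => by positivity)
      (fun n => Real.rpow_nonneg (Real.rpow_nonneg (hI n) _) _) (fun n => ?_) N
    · calc _ ≤ (((1 + 2 * C) * ∑ i ∈ Finset.range N,
            ((∫ x, |D i x| ^ p ∂μ) ^ (1 / p)) ^ (2 : ℝ)) ^ (p / 2)) ^ (1 / p) :=
            Real.rpow_le_rpow (integral_nonneg fun x => by positivity) key (by positivity)
        _ = _ := by
          rw [← Real.rpow_mul]
          · congr 1; field_simp
          · exact mul_nonneg (by positivity)
              (Finset.sum_nonneg fun i _ => Real.rpow_nonneg (Real.rpow_nonneg (hI i) _) _)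
    · have i1 := (hS n).integrable_abs_rpow hp
      have i2 := ((hS n).integrable_signedPow_mul hp (hD n)).const_mul p
      have i3 := (hS n).integrable_rpow_mul_sq hp2.le (hD n)
      have i4 := (hD n).integrable_abs_rpow hp
      have i12 : Integrable (fun x => |∑ i ∈ Finset.range n, D i x| ^ p
          + p * (signedPow p (∑ i ∈ Finset.range n, D i x) * D n x)) μ := i1.add i2
      have i34 : Integrable (fun x => |∑ i ∈ Finset.range n, D i x| ^ (p - 2) * |D n x| ^ 2
          + |D n x| ^ p) μ := i3.add i4
      have e1 : ((∫ x, |D n x| ^ p ∂μ) ^ (1 / p)) ^ (2 : ℝ) = (∫ x, |D n x| ^ p ∂μ) ^ (2 / p) := by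
        rw [← Real.rpow_mul (hI n)]; congr 1; field_simp
      have e2 : ((∫ x, |D n x| ^ p ∂μ) ^ (2 / p)) ^ (p / 2) = ∫ x, |D n x| ^ p ∂μ := by
        rw [← Real.rpow_mul (hI n)]; field_simp; simp
      have e3 : 1 / (p / 2) = 2 / p := by field_simp
      simp only [e1, e2, e3]
      calc _ ≤ ∫ x, (|∑ i ∈ Finset.range n, D i x| ^ p
            + p * (signedPow p (∑ i ∈ Finset.range n, D i x) * D n x))
            + C * (|∑ i ∈ Finset.range n, D i x| ^ (p - 2) * |D n x| ^ 2
              + |D n x| ^ p) ∂μ := by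
            refine integral_mono ((hS (n + 1)).integrable_abs_rpow hp)
              (i12.add (i34.const_mul C)) fun x => ?_
            simp only [Finset.sum_range_succ]
            exact abs_rpow_add_le_of_two_le hp2.le _ _
        _ = ∫ x, |∑ i ∈ Finset.range n, D i x| ^ p ∂μ
            + C * (∫ x, |∑ i ∈ Finset.range n, D i x| ^ (p - 2) * |D n x| ^ 2 ∂μ
              + ∫ x, |D n x| ^ p ∂μ) := by
            rw [integral_add i12 (i34.const_mul C), integral_add i1 i2,
              integral_const_mul, integral_const_mul, horth n, integral_add i3 i4]
            ring
        _ ≤ _ := by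
            gcongr
            exact integral_rpow_mul_sq_le hp2 (hS n) (hD n)

theorem eLpNorm_sum_le_of_signedPow_orthogonal (hp : 1 < p) : ∃ K : ℝ, 0 ≤ K ∧
    ∀ {Ω : Type*} [MeasurableSpace Ω] {μ : Measure Ω} (D : ℕ → Ω → ℝ),
    (∀ n, MemLp (D n) (ENNReal.ofReal p) μ) →
    (∀ n, ∫ x, signedPow p (∑ i ∈ Finset.range n, D i x) * D n x ∂μ = 0) → ∀ N,
    eLpNorm (∑ i ∈ Finset.range N, D i) (ENNReal.ofReal p) μ ≤
      ENNReal.ofReal K * (∑ i ∈ Finset.range N,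
        eLpNorm (D i) (ENNReal.ofReal p) μ ^ min 2 p) ^ (1 / min 2 p) := by
  obtain ⟨K, hK, h⟩ := integral_abs_rpow_sum_le hp
  refine ⟨K, hK, fun {Ω _ μ} D hD horth N => ?_⟩
  have hr : 0 < min 2 p := by positivity
  have e : ∀ {g : Ω → ℝ}, MemLp g (ENNReal.ofReal p) μ → eLpNorm g (ENNReal.ofReal p) μ
      = ENNReal.ofReal ((∫ x, |g x| ^ p ∂μ) ^ (1 / p)) := fun {g} hg => by
    rw [hg.eLpNorm_eq_integral_rpow_norm (by simp; linarith) ENNReal.ofReal_ne_top,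
      ENNReal.toReal_ofReal (by linarith)]
    simp
  rw [e (memLp_finsetSum' _ fun i _ => hD i)]
  simp only [fun i => e (hD i), Finset.sum_apply]
  have hI : ∀ i, 0 ≤ (∫ x, |D i x| ^ p ∂μ) ^ (1 / p) :=
    fun i => Real.rpow_nonneg (integral_nonneg fun x => by positivity) _
  simp only [fun i => ENNReal.ofReal_rpow_of_nonneg (hI i) hr.le]
  rw [← ENNReal.ofReal_sum_of_nonneg (fun i _ => Real.rpow_nonneg (hI i) _),
    ENNReal.ofReal_rpow_of_nonneg (Finset.sum_nonneg fun i _ => Real.rpow_nonneg (hI i) _)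
      (by positivity), ← ENNReal.ofReal_mul hK]
  exact ENNReal.ofReal_le_ofReal (h D hD horth N)

end MartingaleType

section AlmostMartingale

theorem integral_mul_eq_zero_of_condExp_eq_zero {Ω : Type*} {m m0 : MeasurableSpace Ω}
    {μ : Measure Ω} [IsFiniteMeasure μ] (hm : m ≤ m0) {u D : Ω → ℝ} (hu : StronglyMeasurable[m] u)
    (huD : Integrable (fun x => u x * D x) μ) (hD : Integrable D μ) (h : μ[D|m] =ᵐ[μ] 0) :
    ∫ x, u x * D x ∂μ = 0 := by
  have h1 : μ[u * D|m] =ᵐ[μ] u * μ[D|m] := condExp_mul_of_stronglyMeasurable_left hu huD hD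
  have h2 : ∫ x, (u * D) x ∂μ = 0 := by
    rw [← integral_condExp hm, integral_congr_ae h1]
    have : u * μ[D|m] =ᵐ[μ] 0 := by
      filter_upwards [h] with x hx
      simp [hx]
    rw [integral_congr_ae this]; simp
  exact h2

/-- The increment of the conditional expectations of `g` along the filtration `ℱ`, from time
`n + r - 1` to time `n + r`, except that for `r = 0` it is the conditional expectation at time
`n` itself. -/
noncomputable def condExpIncrement {Ω : Type*} {m0 : MeasurableSpace Ω} (μ : Measure Ω)
    (ℱ : Filtration ℕ m0) (g : Ω → ℝ) (n : ℕ) : ℕ → Ω → ℝ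
  | 0 => μ[g|ℱ n]
  | r + 1 => μ[g|ℱ (n + r + 1)] - μ[g|ℱ (n + r)]

variable {Ω : Type*} {m0 : MeasurableSpace Ω} {μ : Measure Ω}
  {ℱ : Filtration ℕ m0} {p : ℝ} {g : Ω → ℝ}

theorem stronglyMeasurable_condExpIncrement (n r : ℕ) :
    StronglyMeasurable[ℱ (n + r)] (condExpIncrement μ ℱ g n r) := by
  cases r with
  | zero => exact stronglyMeasurable_condExp
  | succ r =>
    exact stronglyMeasurable_condExp.sub (stronglyMeasurable_condExp.mono (ℱ.mono (Nat.le_succ _)))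

theorem sum_condExpIncrement (n R : ℕ) :
    ∑ r ∈ Finset.range (R + 1), condExpIncrement μ ℱ g n r = μ[g|ℱ (n + R)] := by
  induction R with
  | zero => simp [condExpIncrement]
  | succ R ih => rw [Finset.sum_range_succ, ih, condExpIncrement]; simp [add_assoc]

theorem memLp_condExpIncrement (hp : 1 < p) (hg : MemLp g (ENNReal.ofReal p) μ) (n r : ℕ) :
    MemLp (condExpIncrement μ ℱ g n r) (ENNReal.ofReal p) μ := by
  have h1 : 1 ≤ ENNReal.ofReal p := by simpa using hp.le
  cases r with
  | zero => exact hg.condExp h1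
  | succ r => exact (hg.condExp h1).sub (hg.condExp h1)

theorem condExp_condExpIncrement_eq_zero [IsFiniteMeasure μ] (n r : ℕ)
    (hmean : μ[g|ℱ n] =ᵐ[μ] 0) :
    μ[condExpIncrement μ ℱ g (n + 1) r|ℱ (n + r)] =ᵐ[μ] 0 := by
  cases r with
  | zero => exact (condExp_condExp_of_le (ℱ.mono (Nat.le_succ n)) (ℱ.le _)).trans hmean
  | succ r =>
    have e : n + (r + 1) = n + 1 + r := by ring
    refine (condExp_sub integrable_condExp integrable_condExp _).trans ?_
    have h1 : μ[μ[g|ℱ (n + 1 + r + 1)]|ℱ (n + (r + 1))] =ᵐ[μ] μ[g|ℱ (n + (r + 1))] :=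
      condExp_condExp_of_le (ℱ.mono (by omega)) (ℱ.le _)
    have h2 : μ[μ[g|ℱ (n + 1 + r)]|ℱ (n + (r + 1))] =ᵐ[μ] μ[g|ℱ (n + (r + 1))] :=
      condExp_condExp_of_le (ℱ.mono (by omega)) (ℱ.le _)
    filter_upwards [h1, h2] with x hx1 hx2
    simp [hx1, hx2]

theorem eLpNorm_condExpIncrement_le (hp : 1 < p) (hg : MemLp g (ENNReal.ofReal p) μ)
    {B : ℝ} (hB : 0 ≤ B) (n : ℕ)
    (hdecay : ∀ r, eLpNorm (g - μ[g|ℱ (n + r)]) (ENNReal.ofReal p) μ ≤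
      ENNReal.ofReal (B * (1 / 2) ^ r) * eLpNorm g (ENNReal.ofReal p) μ) (r : ℕ) :
    eLpNorm (condExpIncrement μ ℱ g n r) (ENNReal.ofReal p) μ ≤
      ENNReal.ofReal ((1 + 3 * B) * (1 / 2) ^ r) * eLpNorm g (ENNReal.ofReal p) μ := by
  have h1 : 1 ≤ ENNReal.ofReal p := by simpa using hp.le
  cases r with
  | zero =>
    refine (eLpNorm_condExp_le_eLpNorm g h1).trans (le_mul_of_one_le_left (zero_le) ?_)
    simp; linarith
  | succ r =>
    have e : condExpIncrement μ ℱ g n (r + 1)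
        = (g - μ[g|ℱ (n + r)]) - (g - μ[g|ℱ (n + (r + 1))]) := by
      simp [condExpIncrement, add_assoc]
    have m1 : ∀ r, AEStronglyMeasurable (g - μ[g|ℱ (n + r)]) μ :=
      fun r => (hg.sub (hg.condExp h1)).1
    rw [e]
    calc _ ≤ _ := eLpNorm_sub_le (m1 r) (m1 (r + 1)) h1
      _ ≤ ENNReal.ofReal (B * (1 / 2) ^ r) * eLpNorm g (ENNReal.ofReal p) μ
          + ENNReal.ofReal (B * (1 / 2) ^ (r + 1)) * eLpNorm g (ENNReal.ofReal p) μ :=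
        add_le_add (hdecay r) (hdecay (r + 1))
      _ = ENNReal.ofReal (B * (1 / 2) ^ r + B * (1 / 2) ^ (r + 1))
          * eLpNorm g (ENNReal.ofReal p) μ := by
        rw [← add_mul, ENNReal.ofReal_add (by positivity) (by positivity)]
      _ ≤ _ := by
        gcongr
        have : (0:ℝ) < (1 / 2) ^ r := by positivity
        rw [pow_succ]; nlinarith

theorem ENNReal.le_rpow_sum_rpow {ι : Type*} {s : Finset ι} {a : ι → ℝ≥0∞} {r : ℝ} (hr : 0 < r)
    {i : ι} (hi : i ∈ s) : a i ≤ (∑ j ∈ s, a j ^ r) ^ (1 / r) := by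
  calc a i = (a i ^ r) ^ (1 / r) := by rw [← ENNReal.rpow_mul]; field_simp; simp
    _ ≤ _ := by
      gcongr
      exact Finset.single_le_sum (f := fun j => a j ^ r) (fun _ _ => zero_le) hi

theorem eLpNorm_sum_le_of_condExp_decay {p : ℝ} (hp : 1 < p) {B : ℝ} (hB : 0 ≤ B) :
    ∃ C : ℝ, 0 ≤ C ∧ ∀ {Ω : Type*} {m0 : MeasurableSpace Ω} {μ : Measure Ω} [IsFiniteMeasure μ]
      (ℱ : Filtration ℕ m0) (G : ℕ → Ω → ℝ), (∀ n, MemLp (G n) (ENNReal.ofReal p) μ) →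
      (∀ n, μ[G (n + 1)|ℱ n] =ᵐ[μ] 0) →
      (∀ n r, eLpNorm (G n - μ[G n|ℱ (n + r)]) (ENNReal.ofReal p) μ ≤
        ENNReal.ofReal (B * (1 / 2) ^ r) * eLpNorm (G n) (ENNReal.ofReal p) μ) → ∀ N,
      eLpNorm (∑ i ∈ Finset.range N, G i) (ENNReal.ofReal p) μ ≤
        ENNReal.ofReal C * (∑ i ∈ Finset.range N,
          eLpNorm (G i) (ENNReal.ofReal p) μ ^ min 2 p) ^ (1 / min 2 p) := by
  obtain ⟨K, hK, hbound⟩ := eLpNorm_sum_le_of_signedPow_orthogonal hp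
  refine ⟨2 * (K * (1 + 3 * B)) + B, by positivity, fun {Ω m0 μ _} ℱ G hG hmean hdecay N => ?_⟩
  have hr : 0 < min 2 p := by positivity
  have h1 : 1 ≤ ENNReal.ofReal p := by simpa using hp.le
  set Γ := (∑ i ∈ Finset.range N, eLpNorm (G i) (ENNReal.ofReal p) μ ^ min 2 p) ^ (1 / min 2 p)
    with hΓ
  have hinc : ∀ r, eLpNorm (∑ i ∈ Finset.range N, condExpIncrement μ ℱ (G i) i r)
      (ENNReal.ofReal p) μ ≤ ENNReal.ofReal (K * (1 + 3 * B) * (1 / 2) ^ r) * Γ := by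
    intro r
    have hmem : ∀ n, MemLp (condExpIncrement μ ℱ (G n) n r) (ENNReal.ofReal p) μ :=
      fun n => memLp_condExpIncrement hp (hG n) n r
    refine (hbound (fun i => condExpIncrement μ ℱ (G i) i r) hmem (fun n => ?_) N).trans ?_
    · cases n with
      | zero => simp [signedPow_zero]
      | succ n =>
        refine integral_mul_eq_zero_of_condExp_eq_zero (ℱ.le (n + r)) ?_
          ((memLp_finsetSum _ fun i _ => hmem i).integrable_signedPow_mul hp (hmem _))
          ((hmem _).integrable h1) (condExp_condExpIncrement_eq_zero n r (hmean n))
        refine Measurable.stronglyMeasurable ((measurable_signedPow p).comp ?_)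
        refine Finset.measurable_fun_sum _ fun i hi => ?_
        exact ((stronglyMeasurable_condExpIncrement i r).mono
          (ℱ.mono (by have := Finset.mem_range.1 hi; omega))).measurable
    · rw [mul_assoc, ENNReal.ofReal_mul hK, mul_assoc]
      gcongr
      calc _ ≤ (∑ i ∈ Finset.range N, (ENNReal.ofReal ((1 + 3 * B) * (1 / 2) ^ r)
            * eLpNorm (G i) (ENNReal.ofReal p) μ) ^ min 2 p) ^ (1 / min 2 p) := by
            gcongr with i hi
            exact eLpNorm_condExpIncrement_le hp (hG i) hB i (hdecay i) r
        _ = _ := by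
          simp only [ENNReal.mul_rpow_of_nonneg _ _ hr.le]
          rw [← Finset.mul_sum, ENNReal.mul_rpow_of_nonneg _ _ (by positivity),
            ← ENNReal.rpow_mul]
          field_simp
          simp [hΓ]
  have hdec : ∑ i ∈ Finset.range N, G i
      = ∑ r ∈ Finset.range (N + 1), ∑ i ∈ Finset.range N, condExpIncrement μ ℱ (G i) i r
        + ∑ i ∈ Finset.range N, (G i - μ[G i|ℱ (i + N)]) := by
    rw [Finset.sum_comm]
    simp [sum_condExpIncrement]
  rw [hdec]
  have hm1 : ∀ r, AEStronglyMeasurable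
      (∑ i ∈ Finset.range N, condExpIncrement μ ℱ (G i) i r) μ :=
    fun r => (memLp_finsetSum' _ fun i _ => memLp_condExpIncrement hp (hG i) i r).1
  have hm2 : ∀ i, AEStronglyMeasurable (G i - μ[G i|ℱ (i + N)]) μ :=
    fun i => ((hG i).sub ((hG i).condExp h1)).1
  calc _ ≤ _ := eLpNorm_add_le (Finset.aestronglyMeasurable_sum _ fun r _ => hm1 r)
        (Finset.aestronglyMeasurable_sum _ fun i _ => hm2 i) h1
    _ ≤ ENNReal.ofReal (2 * (K * (1 + 3 * B))) * Γ + ENNReal.ofReal B * Γ := by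
      gcongr
      · calc _ ≤ _ := eLpNorm_sum_le (fun r _ => hm1 r) h1
          _ ≤ ∑ r ∈ Finset.range (N + 1), ENNReal.ofReal (K * (1 + 3 * B) * (1 / 2) ^ r) * Γ :=
            Finset.sum_le_sum fun r _ => hinc r
          _ = ENNReal.ofReal (K * (1 + 3 * B) * ∑ r ∈ Finset.range (N + 1), (1 / 2) ^ r) * Γ := by
            rw [← Finset.sum_mul, Finset.mul_sum,
              ENNReal.ofReal_sum_of_nonneg (fun i _ => by positivity)]
          _ ≤ _ := by
            refine mul_le_mul_left (ENNReal.ofReal_le_ofReal ?_) Γ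
            rw [mul_comm 2]
            exact mul_le_mul_of_nonneg_left (sum_geometric_two_le _) (by positivity)
      · calc _ ≤ _ := eLpNorm_sum_le (fun r _ => hm2 r) h1
          _ ≤ ∑ i ∈ Finset.range N, ENNReal.ofReal (B * (1 / 2) ^ N) * Γ := by
            refine Finset.sum_le_sum fun i hi => (hdecay i N).trans ?_
            gcongr
            exact ENNReal.le_rpow_sum_rpow (a := fun i => eLpNorm (G i) (ENNReal.ofReal p) μ) hr hi
          _ = ENNReal.ofReal (N * (B * (1 / 2) ^ N)) * Γ := by
            rw [Finset.sum_const, Finset.card_range, nsmul_eq_mul, ← mul_assoc,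
              ENNReal.ofReal_mul (Nat.cast_nonneg N), ENNReal.ofReal_natCast]
          _ ≤ _ := by
            gcongr
            have h2 : (N : ℝ) ≤ 2 ^ N := by exact_mod_cast Nat.lt_two_pow_self.le
            have h3 : (2:ℝ) ^ N * (1 / 2) ^ N = 1 := by rw [← mul_pow]; norm_num
            calc (N : ℝ) * (B * (1 / 2) ^ N) ≤ 2 ^ N * (B * (1 / 2) ^ N) := by gcongr
              _ = B * (2 ^ N * (1 / 2) ^ N) := by ring
              _ = B := by rw [h3, mul_one]
    _ = _ := by rw [← add_mul, ENNReal.ofReal_add (by positivity) hB]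

end AlmostMartingale

section PolynomialEstimate

/-- The polynomial function with coefficients `c`. -/
def polyFun {L : ℕ} (c : Fin (L + 1) → ℝ) (s : ℝ) : ℝ := ∑ i, c i * s ^ (i : ℕ)

theorem continuous_polyFun {L : ℕ} (c : Fin (L + 1) → ℝ) : Continuous (polyFun c) := by
  unfold polyFun; fun_prop

theorem exists_polyFun_ne_zero {L : ℕ} {c : Fin (L + 1) → ℝ} (hc : c ≠ 0) :
    ∃ s ∈ Set.Icc (0 : ℝ) 1, polyFun c s ≠ 0 := by
  by_contra! h
  set q : Polynomial ℝ := ∑ i : Fin (L + 1), Polynomial.monomial i (c i) with hq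
  have hq0 : q = 0 := by
    refine Polynomial.eq_zero_of_infinite_isRoot q ((Set.Icc_infinite zero_lt_one).mono ?_)
    intro s hs
    have := h s hs
    simpa [hq, Polynomial.IsRoot, Polynomial.eval_finsetSum, polyFun] using this
  refine hc (funext fun i => ?_)
  have : q.coeff i = c i := by
    simp [hq, Polynomial.finsetSum_coeff, Polynomial.coeff_monomial, Fin.val_inj]
  rw [← this, hq0]; simp

theorem exists_norm_rpow_le_integral_polyFun (L : ℕ) {p : ℝ} (hp : 0 < p) :
    ∃ C : ℝ, 0 ≤ C ∧ ∀ c : Fin (L + 1) → ℝ, ‖c‖ ^ p ≤ C * ∫ s in (0:ℝ)..1, |polyFun c s| ^ p := by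
  have hcont : Continuous fun c : Fin (L + 1) → ℝ => ∫ s in (0:ℝ)..1, |polyFun c s| ^ p := by
    refine intervalIntegral.continuous_parametric_intervalIntegral_of_continuous'
      (f := fun c s => |polyFun c s| ^ p) ?_ 0 1
    refine Continuous.rpow_const ?_ fun _ => Or.inr hp.le
    unfold polyFun
    fun_prop
  obtain ⟨c₀, hc₀, hmin⟩ := (isCompact_sphere (0 : Fin (L + 1) → ℝ) 1).exists_isMinOn
    (NormedSpace.sphere_nonempty.2 zero_le_one) hcont.continuousOn
  have hc₀' : c₀ ≠ 0 := by
    rintro rfl; simp at hc₀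
  set γ := ∫ s in (0:ℝ)..1, |polyFun c₀ s| ^ p with hγ
  have hγ0 : 0 < γ := by
    obtain ⟨s, hs, hne⟩ := exists_polyFun_ne_zero hc₀'
    refine intervalIntegral.integral_pos zero_lt_one
      (((continuous_polyFun c₀).abs.rpow_const fun _ => Or.inr hp.le).continuousOn)
      (fun x _ => by positivity) ⟨s, hs, by positivity⟩
  refine ⟨γ⁻¹, by positivity, fun c => ?_⟩
  rcases eq_or_ne c 0 with rfl | hc
  · simp [Real.zero_rpow hp.ne', polyFun]
  have hn : 0 < ‖c‖ := norm_pos_iff.2 hc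
  have h1 : γ ≤ ∫ s in (0:ℝ)..1, |polyFun (‖c‖⁻¹ • c) s| ^ p :=
    hmin (by simp [norm_smul, hn.ne'])
  have h2 : ∀ s, |polyFun (‖c‖⁻¹ • c) s| ^ p = (‖c‖ ^ p)⁻¹ * |polyFun c s| ^ p := fun s => by
    have : polyFun (‖c‖⁻¹ • c) s = ‖c‖⁻¹ * polyFun c s := by
      simp [polyFun, Finset.mul_sum, mul_assoc]
    rw [this, abs_mul, Real.mul_rpow (abs_nonneg _) (abs_nonneg _), abs_of_nonneg (by positivity),
      Real.inv_rpow hn.le]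
  simp only [h2, intervalIntegral.integral_const_mul] at h1
  rw [le_inv_mul_iff₀ (by positivity)] at h1
  rw [le_inv_mul_iff₀ hγ0]
  linarith

theorem abs_pow_sub_pow_le_mul_of_mem_Icc {s t : ℝ} (hs : s ∈ Set.Icc (0 : ℝ) 1)
    (ht : t ∈ Set.Icc (0 : ℝ) 1)
    (i : ℕ) : |s ^ i - t ^ i| ≤ i * |s - t| := by
  induction i with
  | zero => simp
  | succ i ih =>
    have e : s ^ (i + 1) - t ^ (i + 1) = s * (s ^ i - t ^ i) + (s - t) * t ^ i := by ring
    rw [e]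
    refine (abs_add_le _ _).trans ?_
    rw [abs_mul, abs_mul, abs_of_nonneg hs.1, abs_of_nonneg (pow_nonneg ht.1 i)]
    have h1 : s * |s ^ i - t ^ i| ≤ |s ^ i - t ^ i| :=
      mul_le_of_le_one_left (abs_nonneg _) hs.2
    have h2 : |s - t| * t ^ i ≤ |s - t| :=
      mul_le_of_le_one_right (abs_nonneg _) (pow_le_one₀ ht.1 ht.2)
    push_cast
    linarith

theorem abs_polyFun_sub_le {L : ℕ} (c : Fin (L + 1) → ℝ) {s t : ℝ}
    (hs : s ∈ Set.Icc (0 : ℝ) 1) (ht : t ∈ Set.Icc (0 : ℝ) 1) :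
    |polyFun c s - polyFun c t| ≤ (L + 1) * L * ‖c‖ * |s - t| := by
  unfold polyFun
  rw [← Finset.sum_sub_distrib]
  refine (Finset.abs_sum_le_sum_abs _ _).trans ?_
  calc _ ≤ ∑ i : Fin (L + 1), ‖c‖ * (L * |s - t|) := by
        refine Finset.sum_le_sum fun i _ => ?_
        rw [← mul_sub, abs_mul]
        refine mul_le_mul (norm_le_pi_norm c i)
          ((abs_pow_sub_pow_le_mul_of_mem_Icc hs ht i).trans ?_)
          (abs_nonneg _) (norm_nonneg _)
        gcongr
        exact Nat.lt_succ_iff.1 i.2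
    _ = _ := by simp; ring

theorem exists_eval_sub_rpow_le_integral (L : ℕ) {p : ℝ} (hp : 0 < p) :
    ∃ C : ℝ, 0 ≤ C ∧ ∀ q : Polynomial ℝ, q.natDegree ≤ L → ∀ a h : ℝ, 0 < h →
      ∀ s ∈ Set.Icc a (a + h), ∀ t ∈ Set.Icc a (a + h),
      |q.eval s - q.eval t| ^ p
        ≤ C * (|s - t| / h) ^ p * h⁻¹ * ∫ x in a..a + h, |q.eval x| ^ p := by
  obtain ⟨C, hC, hbd⟩ := exists_norm_rpow_le_integral_polyFun L hp
  refine ⟨((L + 1) * L) ^ p * C, by positivity, fun q hq a h hh s hs t ht => ?_⟩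
  set Q : Polynomial ℝ := q.comp (Polynomial.C h * Polynomial.X + Polynomial.C a) with hQ
  have hQd : Q.natDegree ≤ L := by
    refine Polynomial.natDegree_comp_le.trans ?_
    calc q.natDegree * _ ≤ q.natDegree * 1 := by
          gcongr; exact Polynomial.natDegree_linear_le
      _ ≤ L := by simpa using hq
  set c : Fin (L + 1) → ℝ := fun i => Q.coeff i
  have hc : ∀ x, polyFun c x = q.eval (h * x + a) := fun x => by
    have : Q.eval x = q.eval (h * x + a) := by simp [hQ]
    rw [← this, Polynomial.eval_eq_sum_range' (Nat.lt_succ_iff.2 hQd), polyFun,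
      ← Fin.sum_univ_eq_sum_range (fun i => Q.coeff i * x ^ i)]
  have hu : ∀ x ∈ Set.Icc a (a + h), (x - a) / h ∈ Set.Icc (0:ℝ) 1 := fun x hx => by
    constructor
    · exact div_nonneg (by linarith [hx.1]) hh.le
    · rw [div_le_one hh]; linarith [hx.2]
  have hv : ∀ x, q.eval x = polyFun c ((x - a) / h) := fun x => by
    rw [hc]; congr 1; field_simp; ring
  have h1 := abs_polyFun_sub_le c (hu s hs) (hu t ht)
  rw [← hv, ← hv, ← sub_div, sub_sub_sub_cancel_right, abs_div, abs_of_pos hh] at h1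
  have h2 := hbd c
  simp only [hc] at h2
  rw [intervalIntegral.integral_comp_mul_add (fun x => |q.eval x| ^ p) hh.ne'] at h2
  simp only [mul_zero, zero_add, mul_one, smul_eq_mul, add_comm h a] at h2
  calc _ ≤ ((L + 1) * L * ‖c‖ * (|s - t| / h)) ^ p :=
        Real.rpow_le_rpow (abs_nonneg _) h1 hp.le
    _ = ((L + 1) * L) ^ p * ‖c‖ ^ p * (|s - t| / h) ^ p := by
        rw [Real.mul_rpow (by positivity) (by positivity),
          Real.mul_rpow (by positivity) (by positivity)]
    _ ≤ ((L + 1) * L) ^ p * (C * (h⁻¹ * ∫ x in a..a + h, |q.eval x| ^ p)) * (|s - t| / h) ^ p := by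
        gcongr
    _ = _ := by ring

end PolynomialEstimate

section Dyadic

/-- The half-open dyadic interval `[ν / 2^n, (ν + 1) / 2^n)`. -/
def dyadicIco (n ν : ℕ) : Set ℝ := Set.Ico ((ν : ℝ) / 2 ^ n) ((ν + 1) / 2 ^ n)

/-- The largest multiple of `2^{-m}` not exceeding `t`. -/
noncomputable def dyadicFloor (m : ℕ) (t : ℝ) : ℝ := ⌊2 ^ m * t⌋ / 2 ^ m

theorem measurableSet_dyadicIco (n ν : ℕ) : MeasurableSet (dyadicIco n ν) := measurableSet_Ico

theorem mem_dyadicIco_iff {n ν : ℕ} {t : ℝ} : t ∈ dyadicIco n ν ↔ ⌊2 ^ n * t⌋ = (ν : ℤ) := by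
  rw [dyadicIco, Set.mem_Ico, Int.floor_eq_iff, div_le_iff₀ (by positivity),
    lt_div_iff₀ (by positivity), mul_comm t]
  simp

theorem measurable_dyadicFloor (m : ℕ) : Measurable (dyadicFloor m) := by
  unfold dyadicFloor; fun_prop

theorem floor_two_pow_mul_dyadicFloor {n m : ℕ} (h : n ≤ m) (t : ℝ) :
    ⌊2 ^ n * dyadicFloor m t⌋ = ⌊2 ^ n * t⌋ := by
  obtain ⟨k, rfl⟩ := Nat.exists_eq_add_of_le h
  have h1 : (2:ℝ) ^ n * dyadicFloor (n + k) t
      = (⌊2 ^ (n + k) * t⌋ : ℝ) / ((2 ^ k : ℕ) : ℝ) := by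
    rw [dyadicFloor]; generalize (⌊2 ^ (n + k) * t⌋ : ℝ) = z
    push_cast; rw [pow_add]; field_simp
  have h2 : (2:ℝ) ^ n * t = 2 ^ (n + k) * t / ((2 ^ k : ℕ) : ℝ) := by
    push_cast; rw [pow_add]; field_simp
  rw [h1, h2, Int.floor_div_natCast, Int.floor_div_natCast, Int.floor_intCast]

theorem dyadicFloor_dyadicFloor {n m : ℕ} (h : n ≤ m) (t : ℝ) :
    dyadicFloor n (dyadicFloor m t) = dyadicFloor n t := by
  rw [dyadicFloor, floor_two_pow_mul_dyadicFloor h, dyadicFloor]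

theorem dyadicFloor_mem_dyadicIco {n m ν : ℕ} (h : n ≤ m) {t : ℝ} (ht : t ∈ dyadicIco n ν) :
    dyadicFloor m t ∈ dyadicIco n ν := by
  rw [mem_dyadicIco_iff] at *
  rw [floor_two_pow_mul_dyadicFloor h, ht]

theorem abs_sub_dyadicFloor_le (m : ℕ) (t : ℝ) : |t - dyadicFloor m t| ≤ (1 / 2) ^ m := by
  have h1 := Int.floor_le (2 ^ m * t)
  have h2 := Int.lt_floor_add_one (2 ^ m * t)
  have e : t - dyadicFloor m t = (2 ^ m * t - ⌊2 ^ m * t⌋) / 2 ^ m := by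
    rw [dyadicFloor]; field_simp
  rw [e, abs_of_nonneg (div_nonneg (by linarith) (by positivity)), one_div_pow]
  gcongr
  linarith

theorem dyadicIco_subset_Ico {n ν : ℕ} (hν : ν < 2 ^ n) : dyadicIco n ν ⊆ Set.Ico 0 1 := by
  refine Set.Ico_subset_Ico (by positivity) ?_
  rw [div_le_one (by positivity)]
  exact_mod_cast hν

theorem volume_dyadicIco (n ν : ℕ) : volume (dyadicIco n ν) = ENNReal.ofReal ((1 / 2) ^ n) := by
  rw [dyadicIco, Real.volume_Ico]
  congr 1
  field_simp
  rw [one_div_pow]; field_simp; ring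

theorem iUnion_dyadicIco (n : ℕ) :
    ⋃ ν ∈ Finset.range (2 ^ n), dyadicIco n ν = Set.Ico (0 : ℝ) 1 := by
  refine Set.Subset.antisymm
    (Set.iUnion₂_subset fun ν hν => dyadicIco_subset_Ico (Finset.mem_range.1 hν)) fun t ht => ?_
  have h0 : 0 ≤ ⌊2 ^ n * t⌋ := Int.floor_nonneg.2 (mul_nonneg (by positivity) ht.1)
  have h1 : ⌊2 ^ n * t⌋ < 2 ^ n := by
    rw [Int.floor_lt]
    push_cast
    nlinarith [ht.2, (by positivity : (0:ℝ) < 2 ^ n)]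
  lift ⌊2 ^ n * t⌋ to ℕ using h0 with ν hν
  rw [Set.mem_iUnion₂]
  exact ⟨ν, Finset.mem_range.2 (by exact_mod_cast h1), mem_dyadicIco_iff.2 hν.symm⟩

theorem pairwiseDisjoint_dyadicIco (n : ℕ) (s : Set ℕ) : s.PairwiseDisjoint (dyadicIco n) := by
  intro ν _ ν' _ hne
  refine Set.disjoint_left.2 fun t h h' => hne ?_
  rw [mem_dyadicIco_iff] at h h'
  exact_mod_cast h.symm.trans h'

theorem restrict_Ioo_eq_sum_dyadicIco (n : ℕ) :
    (volume : Measure ℝ).restrict (Set.Ioo 0 1)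
      = ∑ ν ∈ Finset.range (2 ^ n), volume.restrict (dyadicIco n ν) := by
  rw [Measure.restrict_congr_set Ioo_ae_eq_Ico, ← iUnion_dyadicIco n,
    Measure.restrict_biUnion_finset
    (fun ν _ ν' _ h => pairwiseDisjoint_dyadicIco n Set.univ (Set.mem_univ ν) (Set.mem_univ ν') h)
    (fun ν => measurableSet_dyadicIco n ν), Measure.sum_fintype]
  exact Finset.sum_coe_sort (Finset.range (2 ^ n)) fun ν => volume.restrict (dyadicIco n ν)

/-- `g` agrees on each half-open dyadic interval of length `2^{-n}` with a polynomial of degree at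
most `L`. -/
def IsDyadicPoly (n L : ℕ) (g : ℝ → ℝ) : Prop :=
  ∀ ν : ℕ, ∃ q : Polynomial ℝ, q.natDegree ≤ L ∧ ∀ t ∈ dyadicIco n ν, g t = q.eval t

theorem IsDyadicPoly.sum {ι : Type*} {s : Finset ι} {n L : ℕ} {g : ι → ℝ → ℝ}
    (h : ∀ i ∈ s, IsDyadicPoly n L (g i)) : IsDyadicPoly n L (fun t => ∑ i ∈ s, g i t) := by
  intro ν
  choose! q hq hgq using fun i hi => h i hi ν
  refine ⟨∑ i ∈ s, q i, Polynomial.natDegree_sum_le_of_forall_le s q hq, fun t ht => ?_⟩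
  rw [Polynomial.eval_finsetSum]
  exact Finset.sum_congr rfl fun i hi => hgq i hi t ht

theorem IsDyadicPoly.const_mul {n L : ℕ} {g : ℝ → ℝ} (h : IsDyadicPoly n L g) (c : ℝ) :
    IsDyadicPoly n L (fun t => c * g t) := by
  intro ν
  obtain ⟨q, hq, hgq⟩ := h ν
  exact ⟨Polynomial.C c * q, (Polynomial.natDegree_C_mul_le c q).trans hq,
    fun t ht => by simp [hgq t ht]⟩

theorem mem_dyadicIco_of_le {n m ν : ℕ} (h : n ≤ m) {t : ℝ} (ht : t ∈ dyadicIco m ν) :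
    t ∈ dyadicIco n (ν / 2 ^ (m - n)) := by
  obtain ⟨k, rfl⟩ := Nat.exists_eq_add_of_le h
  rw [mem_dyadicIco_iff] at *
  rw [← floor_two_pow_mul_dyadicFloor h, dyadicFloor, ht]
  have : (2:ℝ) ^ n * (((ν : ℤ) : ℝ) / 2 ^ (n + k)) = (ν : ℝ) / ((2 ^ k : ℕ) : ℝ) := by
    push_cast; rw [pow_add]; field_simp
  rw [this, Int.floor_div_natCast]
  simp

theorem IsDyadicPoly.mono {n m L : ℕ} {g : ℝ → ℝ} (h : IsDyadicPoly n L g) (hnm : n ≤ m) :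
    IsDyadicPoly m L g := by
  intro ν
  obtain ⟨q, hq, hgq⟩ := h (ν / 2 ^ (m - n))
  exact ⟨q, hq, fun t ht => hgq t (mem_dyadicIco_of_le hnm ht)⟩

theorem exists_lintegral_sub_dyadicFloor_le (L : ℕ) {p : ℝ} (hp : 0 < p) :
    ∃ C : ℝ, 0 ≤ C ∧ ∀ (n r : ℕ) (g : ℝ → ℝ), IsDyadicPoly n L g →
      ∫⁻ t in Set.Ioo (0:ℝ) 1, ‖g t - g (dyadicFloor (n + r) t)‖ₑ ^ p ≤
        ENNReal.ofReal (C * ((1 / 2) ^ r) ^ p) * ∫⁻ t in Set.Ioo (0:ℝ) 1, ‖g t‖ₑ ^ p := by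
  obtain ⟨C, hC, hbd⟩ := exists_eval_sub_rpow_le_integral L hp
  refine ⟨C, hC, fun n r g hg => ?_⟩
  rw [restrict_Ioo_eq_sum_dyadicIco n, lintegral_finsetSum_measure, lintegral_finsetSum_measure,
    Finset.mul_sum]
  refine Finset.sum_le_sum fun ν _ => ?_
  obtain ⟨q, hq, hgq⟩ := hg ν
  set h : ℝ := (1 / 2) ^ n with hh
  have hh0 : 0 < h := by positivity
  set a : ℝ := (ν : ℝ) / 2 ^ n with ha
  have hcell : dyadicIco n ν = Set.Ico a (a + h) := by
    rw [dyadicIco, ha, hh, one_div_pow]; congr 1; ring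
  have hint : ∫⁻ t in dyadicIco n ν, ‖g t‖ₑ ^ p
      = ENNReal.ofReal (∫ x in a..a + h, |q.eval x| ^ p) := by
    have hqc : Continuous fun x => |q.eval x| ^ p :=
      (q.continuous.abs).rpow_const fun _ => Or.inr hp.le
    rw [intervalIntegral.integral_of_le (by linarith), ← integral_Ico_eq_integral_Ioc, ← hcell,
      ofReal_integral_eq_lintegral_ofReal]
    · refine setLIntegral_congr_fun (measurableSet_dyadicIco n ν) fun t ht => ?_
      rw [hgq t ht, Real.enorm_eq_ofReal_abs, ENNReal.ofReal_rpow_of_nonneg (abs_nonneg _) hp.le]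
    · rw [hcell]
      exact (hqc.integrableOn_Icc).mono_set Set.Ico_subset_Icc_self
    · exact Filter.Eventually.of_forall fun x => by positivity
  have hI : 0 ≤ ∫ x in a..a + h, |q.eval x| ^ p :=
    intervalIntegral.integral_nonneg (by linarith) fun x _ => by positivity
  calc _ ≤ ∫⁻ _ in dyadicIco n ν, ENNReal.ofReal
        (C * ((1 / 2) ^ r) ^ p * h⁻¹ * ∫ x in a..a + h, |q.eval x| ^ p) := by
        refine setLIntegral_mono' (measurableSet_dyadicIco n ν) fun t ht => ?_
        have ht' := dyadicFloor_mem_dyadicIco (Nat.le_add_right n r) ht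
        rw [hgq t ht, hgq _ ht', Real.enorm_eq_ofReal_abs,
          ENNReal.ofReal_rpow_of_nonneg (abs_nonneg _) hp.le]
        refine ENNReal.ofReal_le_ofReal ?_
        rw [hcell] at ht ht'
        refine (hbd q hq a h hh0 t (Set.Ico_subset_Icc_self ht) _
          (Set.Ico_subset_Icc_self ht')).trans ?_
        gcongr
        rw [div_le_iff₀ hh0, hh, ← pow_add, add_comm r n]
        exact abs_sub_dyadicFloor_le _ _
    _ = _ := by
        rw [setLIntegral_const, volume_dyadicIco, hint, ← ENNReal.ofReal_mul (by positivity),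
          ← ENNReal.ofReal_mul (by positivity)]
        congr 1
        rw [← hh]
        field_simp

end Dyadic

noncomputable section Coordinate

theorem measurePreserving_update {ι : Type*} [Fintype ι] [DecidableEq ι] (μ : ι → Measure ℝ)
    [∀ i, IsProbabilityMeasure (μ i)] (j : ι) :
    MeasurePreserving (fun z : (ι → ℝ) × ℝ => Function.update z.1 j z.2)
      ((Measure.pi μ).prod (μ j)) (Measure.pi μ) := by
  have hm : Measurable fun z : (ι → ℝ) × ℝ => Function.update z.1 j z.2 := measurable_update'
  refine ⟨hm, (Measure.pi_eq fun s hs => ?_).symm⟩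
  rw [Measure.map_apply hm (MeasurableSet.univ_pi hs)]
  have : (fun z : (ι → ℝ) × ℝ => Function.update z.1 j z.2) ⁻¹' Set.univ.pi s
      = (Set.univ.pi (Function.update s j Set.univ)) ×ˢ s j := by
    ext ⟨x, t⟩
    simp only [Set.mem_preimage, Set.mem_univ_pi, Set.mem_prod]
    constructor
    · intro h
      refine ⟨fun i => ?_, by simpa using h j⟩
      by_cases hi : i = j
      · subst hi; simp
      · simpa [hi] using h i
    · rintro ⟨h1, h2⟩ i
      by_cases hi : i = j
      · subst hi; simpa using h2
      · simpa [hi] using h1 i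
  rw [this, Measure.prod_prod, Measure.pi_pi, ← Finset.mul_prod_erase _ _ (Finset.mem_univ j),
    ← Finset.mul_prod_erase _ (fun i => μ i (s i)) (Finset.mem_univ j), mul_comm]
  simp only [Function.update_self, measure_univ, one_mul]
  congr 1
  exact Finset.prod_congr rfl fun i hi => by
    rw [Function.update_of_ne (Finset.ne_of_mem_erase hi)]

theorem cubeMeasure_eq_pi (d : ℕ) :
    cubeMeasure d = Measure.pi fun _ => volume.restrict (Set.Ioo (0:ℝ) 1) := by
  rw [cubeMeasure, unitCube, volume_pi, Measure.restrict_pi_pi]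

instance : IsProbabilityMeasure ((volume : Measure ℝ).restrict (Set.Ioo 0 1)) :=
  ⟨by simp⟩

instance (d : ℕ) : IsProbabilityMeasure (cubeMeasure d) := by
  rw [cubeMeasure_eq_pi]; infer_instance

theorem measurableSet_unitCube (d : ℕ) : MeasurableSet (unitCube d) :=
  MeasurableSet.univ_pi fun _ => measurableSet_Ioo

theorem ae_mem_unitCube (d : ℕ) : ∀ᵐ x ∂(cubeMeasure d), x ∈ unitCube d :=
  ae_restrict_mem (measurableSet_unitCube d)

variable {d : ℕ} (j : Fin d)

theorem measurePreserving_update_cubeMeasure :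
    MeasurePreserving (fun z : (Fin d → ℝ) × ℝ => Function.update z.1 j z.2)
      ((cubeMeasure d).prod (volume.restrict (Set.Ioo (0:ℝ) 1))) (cubeMeasure d) := by
  rw [cubeMeasure_eq_pi]
  exact measurePreserving_update (fun _ : Fin d => volume.restrict (Set.Ioo (0:ℝ) 1)) j

theorem lintegral_lintegral_update {f : (Fin d → ℝ) → ℝ≥0∞} (hf : Measurable f) :
    ∫⁻ x, (∫⁻ t in Set.Ioo (0:ℝ) 1, f (Function.update x j t)) ∂(cubeMeasure d)
      = ∫⁻ x, f x ∂(cubeMeasure d) := by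
  have h := measurePreserving_update_cubeMeasure j
  rw [← h.lintegral_comp hf]
  exact (lintegral_prod _ (hf.comp h.measurable).aemeasurable).symm

theorem integral_integral_update {f : (Fin d → ℝ) → ℝ} (hf : Integrable f (cubeMeasure d)) :
    ∫ x, (∫ t in Set.Ioo (0:ℝ) 1, f (Function.update x j t)) ∂(cubeMeasure d)
      = ∫ x, f x ∂(cubeMeasure d) := by
  have h := measurePreserving_update_cubeMeasure j
  have e := integral_map (f := f) h.measurable.aemeasurable (by rw [h.map_eq]; exact hf.1)
  rw [h.map_eq] at e
  rw [e, integral_prod]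
  exact h.integrable_comp_of_integrable hf

/-- Round the `j`-th coordinate down to a multiple of `2^{-m}`. -/
def coordFloor (m : ℕ) (x : Fin d → ℝ) : Fin d → ℝ :=
  Function.update x j (dyadicFloor m (x j))

theorem measurable_coordFloor (m : ℕ) : Measurable (coordFloor j m) := by
  refine measurable_pi_lambda _ fun i => ?_
  by_cases hi : i = j
  · subst hi
    simpa [coordFloor, Function.comp_def] using
      (measurable_dyadicFloor m).comp (measurable_pi_apply i)
  · simpa [coordFloor, hi] using measurable_pi_apply i

theorem coordFloor_update (m : ℕ) (x : Fin d → ℝ) (t : ℝ) :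
    coordFloor j m (Function.update x j t) = Function.update x j (dyadicFloor m t) := by
  simp [coordFloor]

theorem coordFloor_coordFloor {n m : ℕ} (h : n ≤ m) (x : Fin d → ℝ) :
    coordFloor j n (coordFloor j m x) = coordFloor j n x := by
  simp [coordFloor, dyadicFloor_dyadicFloor h]

/-- The filtration of dyadic information on the `j`-th coordinate, all other coordinates being
known exactly. -/
def coordFiltration : Filtration ℕ (inferInstance : MeasurableSpace (Fin d → ℝ)) where
  seq m := MeasurableSpace.comap (coordFloor j m) inferInstance
  mono' n m h := by
    rintro _ ⟨s, hs, rfl⟩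
    refine ⟨coordFloor j n ⁻¹' s, measurable_coordFloor j n hs, ?_⟩
    ext x
    simp [coordFloor_coordFloor j h]
  le' m := (measurable_coordFloor j m).comap_le

/-- `G` is a dyadic polynomial of level `n` in the `j`-th coordinate. -/
def IsDyadicPolyIn (n L : ℕ) (G : (Fin d → ℝ) → ℝ) : Prop :=
  ∀ x ∈ unitCube d, IsDyadicPoly n L fun t => G (Function.update x j t)

/-- `G` has zero mean in the `j`-th coordinate over each dyadic interval of level `n`. -/
def HasZeroMeansIn (n : ℕ) (G : (Fin d → ℝ) → ℝ) : Prop :=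
  ∀ x ∈ unitCube d, ∀ ν < 2 ^ n, ∫ t in dyadicIco n ν, G (Function.update x j t) = 0

theorem IsDyadicPoly.integrable {n L : ℕ} {g : ℝ → ℝ} (hg : IsDyadicPoly n L g) :
    Integrable g (volume.restrict (Set.Ioo (0:ℝ) 1)) := by
  rw [restrict_Ioo_eq_sum_dyadicIco n, integrable_finsetSum_measure]
  intro ν _
  obtain ⟨q, -, hq⟩ := hg ν
  refine (integrableOn_congr_fun hq (measurableSet_dyadicIco n ν)).2 ?_
  exact q.continuous.integrableOn_Icc.mono_set Set.Ico_subset_Icc_self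

theorem condExp_coordFiltration_eq_zero {n m L : ℕ} {G : (Fin d → ℝ) → ℝ}
    (hG : Integrable G (cubeMeasure d)) (hp : IsDyadicPolyIn j m L G)
    (hz : HasZeroMeansIn j n G) :
    (cubeMeasure d)[G|coordFiltration j n] =ᵐ[cubeMeasure d] 0 := by
  refine (ae_eq_condExp_of_forall_setIntegral_eq ((coordFiltration j).le n) hG
    (fun s _ _ => integrableOn_zero) (fun s hs _ => ?_) aestronglyMeasurable_zero).symm
  have hs' : MeasurableSet s := (coordFiltration j).le n s hs
  obtain ⟨B, hB, rfl⟩ := hs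
  simp only [integral_zero]
  rw [← integral_indicator hs', ← integral_integral_update j (hG.indicator hs')]
  refine (integral_eq_zero_of_ae ?_).symm
  filter_upwards [ae_mem_unitCube d] with x hx
  rw [Pi.zero_apply]
  have hsl : MeasurableSet ((fun t => Function.update x j t) ⁻¹' (coordFloor j n ⁻¹' B)) :=
    (measurable_update x) hs'
  have hint : Integrable (fun t => (coordFloor j n ⁻¹' B).indicator G (Function.update x j t))
      (volume.restrict (Set.Ioo (0:ℝ) 1)) := (hp x hx).integrable.indicator hsl
  rw [restrict_Ioo_eq_sum_dyadicIco n] at hint ⊢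
  rw [integral_finsetSum_measure (integrable_finsetSum_measure.1 hint)]
  refine Finset.sum_eq_zero fun ν hν => ?_
  by_cases hB : Function.update x j ((ν : ℝ) / 2 ^ n) ∈ B
  · rw [← hz x hx ν (Finset.mem_range.1 hν)]
    refine setIntegral_congr_fun (measurableSet_dyadicIco n ν) fun t ht => ?_
    refine Set.indicator_of_mem ?_ _
    rw [mem_dyadicIco_iff] at ht
    rwa [Set.mem_preimage, coordFloor_update, dyadicFloor, ht, Int.cast_natCast]
  · refine setIntegral_eq_zero_of_forall_eq_zero fun t ht => ?_
    refine Set.indicator_of_notMem ?_ _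
    rw [mem_dyadicIco_iff] at ht
    rwa [Set.mem_preimage, coordFloor_update, dyadicFloor, ht, Int.cast_natCast]

theorem exists_eLpNorm_sub_coordFloor_le (L : ℕ) {p : ℝ} (hp : 0 < p) :
    ∃ C : ℝ, 0 ≤ C ∧ ∀ {d : ℕ} (j : Fin d) (n r : ℕ) (G : (Fin d → ℝ) → ℝ), Measurable G →
      IsDyadicPolyIn j n L G →
      eLpNorm (G - G ∘ coordFloor j (n + r)) (ENNReal.ofReal p) (cubeMeasure d) ≤
        ENNReal.ofReal (C * (1 / 2) ^ r) * eLpNorm G (ENNReal.ofReal p) (cubeMeasure d) := by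
  obtain ⟨C, hC, h⟩ := exists_lintegral_sub_dyadicFloor_le L hp
  refine ⟨C ^ (1 / p), by positivity, fun {d} j n r G hGm hG => ?_⟩
  have hp0 : ENNReal.ofReal p ≠ 0 := by simpa using hp
  rw [eLpNorm_eq_lintegral_rpow_enorm_toReal hp0 ofReal_ne_top,
    eLpNorm_eq_lintegral_rpow_enorm_toReal hp0 ofReal_ne_top, ENNReal.toReal_ofReal hp.le]
  have hGf : Measurable (G ∘ coordFloor j (n + r)) := hGm.comp (measurable_coordFloor j _)
  rw [← lintegral_lintegral_update j ((hGm.sub hGf).enorm.pow_const p),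
    ← lintegral_lintegral_update j (hGm.enorm.pow_const p)]
  have hconst : ENNReal.ofReal (C ^ (1 / p) * (1 / 2) ^ r)
      = ENNReal.ofReal (C * ((1 / 2) ^ r) ^ p) ^ (1 / p) := by
    rw [ENNReal.ofReal_rpow_of_nonneg (by positivity) (by positivity),
      Real.mul_rpow hC (by positivity), ← Real.rpow_mul (by positivity),
      mul_one_div_cancel hp.ne', Real.rpow_one]
  rw [hconst, ← ENNReal.mul_rpow_of_nonneg _ _ (by positivity)]
  gcongr
  rw [← lintegral_const_mul' _ _ ofReal_ne_top]
  refine lintegral_mono_ae ?_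
  filter_upwards [ae_mem_unitCube d] with x hx
  simpa [coordFloor_update] using h n r _ (hG x hx)

theorem exists_eLpNorm_sum_le_of_isDyadicPolyIn (L : ℕ) {p : ℝ} (hp : 1 < p) :
    ∃ C : ℝ, 0 ≤ C ∧ ∀ {d : ℕ} (j : Fin d) (G : ℕ → (Fin d → ℝ) → ℝ),
      (∀ n, Measurable (G n)) → (∀ n, MemLp (G n) (ENNReal.ofReal p) (cubeMeasure d)) →
      (∀ n, IsDyadicPolyIn j n L (G n)) → (∀ n, HasZeroMeansIn j n (G (n + 1))) → ∀ N,
      eLpNorm (∑ i ∈ Finset.range N, G i) (ENNReal.ofReal p) (cubeMeasure d) ≤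
        ENNReal.ofReal C * (∑ i ∈ Finset.range N,
          eLpNorm (G i) (ENNReal.ofReal p) (cubeMeasure d) ^ min 2 p) ^ (1 / min 2 p) := by
  obtain ⟨B, hB, hdec⟩ := exists_eLpNorm_sub_coordFloor_le L (zero_lt_one.trans hp)
  obtain ⟨C, hC, hsum⟩ := eLpNorm_sum_le_of_condExp_decay hp (B := 2 * B) (by positivity)
  have hp1 : 1 ≤ ENNReal.ofReal p := by simpa using hp.le
  refine ⟨C, hC, fun {d} j G hGm hG hpoly hz N => hsum (coordFiltration j) G hG (fun n => ?_)
    (fun n r => ?_) N⟩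
  · exact condExp_coordFiltration_eq_zero j ((hG _).integrable hp1) (hpoly _) (hz n)
  · set H : (Fin d → ℝ) → ℝ := G n ∘ coordFloor j (n + r) with hH
    have hHm : Measurable H := (hGm n).comp (measurable_coordFloor j _)
    have hD := hdec j n r (G n) (hGm n) (hpoly n)
    rw [← hH] at hD
    have hDL : MemLp (G n - H) (ENNReal.ofReal p) (cubeMeasure d) :=
      ⟨((hGm n).sub hHm).aestronglyMeasurable,
        hD.trans_lt (ENNReal.mul_lt_top ofReal_lt_top (hG n).2)⟩
    have hHL : MemLp H (ENNReal.ofReal p) (cubeMeasure d) := by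
      simpa using (hG n).sub hDL
    have hHF : StronglyMeasurable[coordFiltration j (n + r)] H := by
      have : Measurable[coordFiltration j (n + r)] H :=
        (hGm n).comp (comap_measurable _)
      exact this.stronglyMeasurable
    have hce : (cubeMeasure d)[G n - H|coordFiltration j (n + r)] =ᵐ[cubeMeasure d]
        (cubeMeasure d)[G n|coordFiltration j (n + r)] - H := by
      refine (condExp_sub ((hG n).integrable hp1) (hHL.integrable hp1) _).trans ?_
      rw [condExp_of_stronglyMeasurable ((coordFiltration j).le _) hHF (hHL.integrable hp1)]
    have heq : G n - (cubeMeasure d)[G n|coordFiltration j (n + r)] =ᵐ[cubeMeasure d]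
        (G n - H) - (cubeMeasure d)[G n - H|coordFiltration j (n + r)] := by
      filter_upwards [hce] with x hx
      simp only [Pi.sub_apply] at hx ⊢
      rw [hx]; ring
    rw [eLpNorm_congr_ae heq]
    calc _ ≤ eLpNorm (G n - H) (ENNReal.ofReal p) (cubeMeasure d)
          + eLpNorm ((cubeMeasure d)[G n - H|coordFiltration j (n + r)]) (ENNReal.ofReal p)
            (cubeMeasure d) :=
          eLpNorm_sub_le hDL.1 integrable_condExp.1 hp1
      _ ≤ eLpNorm (G n - H) (ENNReal.ofReal p) (cubeMeasure d)
          + eLpNorm (G n - H) (ENNReal.ofReal p) (cubeMeasure d) := by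
          gcongr
          exact eLpNorm_condExp_le_eLpNorm _ hp1
      _ = 2 * eLpNorm (G n - H) (ENNReal.ofReal p) (cubeMeasure d) := (two_mul _).symm
      _ ≤ 2 * (ENNReal.ofReal (B * (1 / 2) ^ r)
          * eLpNorm (G n) (ENNReal.ofReal p) (cubeMeasure d)) := by gcongr
      _ = _ := by
          rw [mul_assoc 2 B, ENNReal.ofReal_mul zero_le_two, ENNReal.ofReal_ofNat, mul_assoc]

end Coordinate

noncomputable section Cells

variable {d : ℕ}

/-- The half-open dyadic cell of level `κ` and index `ν`. -/
def dyadicCell (κ ν : Fin d → ℕ) : Set (Fin d → ℝ) :=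
  Set.univ.pi fun i => dyadicIco (κ i) (ν i)

/-- The index of the half-open dyadic cell of level `κ` that contains `x`. -/
def cellIndex (κ : Fin d → ℕ) (x : Fin d → ℝ) : Fin d → ℕ := fun i => ⌊2 ^ κ i * x i⌋₊

theorem measurableSet_dyadicCell (κ ν : Fin d → ℕ) : MeasurableSet (dyadicCell κ ν) :=
  MeasurableSet.univ_pi fun _ => measurableSet_dyadicIco _ _

theorem cellIndex_eq {κ ν : Fin d → ℕ} {x : Fin d → ℝ} (hx : x ∈ dyadicCell κ ν) :
    cellIndex κ x = ν := by
  funext i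
  have := mem_dyadicIco_iff.1 (hx i (Set.mem_univ i))
  rw [cellIndex, ← Int.floor_toNat, this, Int.toNat_natCast]

theorem mem_dyadicCell_cellIndex (κ : Fin d → ℕ) {x : Fin d → ℝ} (hx : ∀ i, 0 ≤ x i) :
    x ∈ dyadicCell κ (cellIndex κ x) := fun i _ => by
  have h : (0:ℝ) ≤ 2 ^ κ i * x i := mul_nonneg (by positivity) (hx i)
  exact mem_dyadicIco_iff.2 (Int.natCast_floor_eq_floor h).symm

theorem cellIndex_lt (κ : Fin d → ℕ) {x : Fin d → ℝ} (hx : x ∈ unitCube d) (i : Fin d) :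
    cellIndex κ x i < 2 ^ κ i := by
  have h := hx i (Set.mem_univ i)
  have h0 : (0:ℝ) < 2 ^ κ i := by positivity
  rw [cellIndex, Nat.floor_lt (mul_nonneg h0.le h.1.le)]
  push_cast
  nlinarith [h.2]

theorem dyadicCell_subset_Icc {κ ν : Fin d → ℕ} (hν : ∀ i, ν i < 2 ^ κ i) :
    dyadicCell κ ν ⊆ Set.Icc 0 1 := fun x hx => by
  have h := fun i => dyadicIco_subset_Ico (hν i) (hx i (Set.mem_univ i))
  exact ⟨fun i => (h i).1, fun i => (h i).2.le⟩

theorem dyadicCube_eq (κ ν : Fin d → ℕ) :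
    dyadicCube d (fun i => (κ i : ℤ)) (fun i => (ν i : ℤ))
      = Set.univ.pi fun i => Set.Ioo ((ν i : ℝ) / 2 ^ κ i) ((ν i + 1) / 2 ^ κ i) := by
  rw [dyadicCube]
  congr 1
  funext i
  simp only [zpow_neg, zpow_natCast, Int.cast_natCast]
  congr 1 <;> field_simp

theorem dyadicCube_ae_eq_dyadicCell (κ ν : Fin d → ℕ) :
    dyadicCube d (fun i => (κ i : ℤ)) (fun i => (ν i : ℤ)) =ᵐ[volume] dyadicCell κ ν := by
  rw [dyadicCube_eq, volume_pi]
  exact Measure.ae_eq_set_pi fun _ _ => Ioo_ae_eq_Ico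

theorem dyadicCube_subset_dyadicCell (κ ν : Fin d → ℕ) :
    dyadicCube d (fun i => (κ i : ℤ)) (fun i => (ν i : ℤ)) ⊆ dyadicCell κ ν := by
  rw [dyadicCube_eq]
  exact Set.pi_mono fun _ _ => Set.Ioo_subset_Ico_self

theorem unitCube_ae_eq_Icc : unitCube d =ᵐ[volume] Set.Icc (0 : Fin d → ℝ) 1 := by
  rw [unitCube, volume_pi]
  exact Measure.univ_pi_Ioo_ae_eq_Icc

theorem cubeMeasure_eq_restrict_Icc :
    cubeMeasure d = volume.restrict (Set.Icc (0 : Fin d → ℝ) 1) :=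
  Measure.restrict_congr_set unitCube_ae_eq_Icc

theorem restrict_cubeMeasure_dyadicCell {κ ν : Fin d → ℕ} (hν : ∀ i, ν i < 2 ^ κ i) :
    (cubeMeasure d).restrict (dyadicCell κ ν) = volume.restrict (dyadicCell κ ν) := by
  rw [cubeMeasure_eq_restrict_Icc, Measure.restrict_restrict (measurableSet_dyadicCell κ ν),
    Set.inter_eq_left.2 (dyadicCell_subset_Icc hν)]

/-- `g` agrees on each half-open dyadic cell of level `κ` with a polynomial of coordinate degrees
at most `l`. -/
def IsCellPoly (l κ : Fin d → ℕ) (g : (Fin d → ℝ) → ℝ) : Prop :=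
  ∀ ν : Fin d → ℕ, ∃ P : MvPolynomial (Fin d) ℝ, degLE d l P ∧
    ∀ x ∈ dyadicCell κ ν, g x = MvPolynomial.eval x P

theorem continuous_eval_mvPolynomial (P : MvPolynomial (Fin d) ℝ) :
    Continuous fun x => MvPolynomial.eval x P := MvPolynomial.continuous_eval P

theorem measurable_cellIndex (κ : Fin d → ℕ) : Measurable (cellIndex κ) :=
  measurable_pi_lambda _ fun i => Nat.measurable_floor.comp
    (measurable_const.mul (measurable_pi_apply i))

theorem measurable_eval_comp_of_countable {β : Type*} [Countable β] [MeasurableSpace β]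
    [MeasurableSingletonClass β] (P : β → MvPolynomial (Fin d) ℝ) {N : (Fin d → ℝ) → β}
    (hN : Measurable N) : Measurable fun x => MvPolynomial.eval x (P (N x)) := by
  have h : Measurable fun z : (Fin d → ℝ) × β => MvPolynomial.eval z.1 (P z.2) :=
    measurable_from_prod_countable_left fun ν => (continuous_eval_mvPolynomial (P ν)).measurable
  exact Measurable.comp (f := fun x => (x, N x)) h (measurable_id.prodMk hN)

/-- A piecewise polynomial function on the open dyadic cubes is almost everywhere equal on the
unit cube to a measurable function that is polynomial on the half-open cells. -/
theorem IsPiecewisePoly.exists_isCellPoly {l κ : Fin d → ℕ} {f : (Fin d → ℝ) → ℝ}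
    (hf : IsPiecewisePoly d l κ f) :
    ∃ g, Measurable g ∧ IsCellPoly l κ g ∧ (∃ M, ∀ x ∈ unitCube d, ‖g x‖ ≤ M) ∧
      ∀ ν : Fin d → ℕ, (∀ i, ν i < 2 ^ κ i) →
        ∀ x ∈ dyadicCube d (fun i => (κ i : ℤ)) (fun i => (ν i : ℤ)), g x = f x := by
  have h : ∀ ν : Fin d → ℕ, ∃ P : MvPolynomial (Fin d) ℝ, degLE d l P ∧
      ((∀ i, ν i < 2 ^ κ i) → ∀ x ∈ dyadicCube d (fun i => (κ i : ℤ)) (fun i => (ν i : ℤ)),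
        f x = MvPolynomial.eval x P) := fun ν => by
    by_cases hν : ∀ i, ν i < 2 ^ κ i
    · obtain ⟨P, hP, hfP⟩ := hf (fun i => (ν i : ℤ)) fun i =>
        ⟨Int.natCast_nonneg _, by simpa using (by exact_mod_cast hν i : ((ν i : ℕ) : ℤ) < 2 ^ κ i)⟩
      exact ⟨P, hP, fun _ => hfP⟩
    · exact ⟨0, fun i => by simp, fun h => absurd h hν⟩
  choose P hP hfP using h
  refine ⟨fun x => MvPolynomial.eval x (P (cellIndex κ x)), ?_, fun ν => ⟨P ν, hP ν, fun x hx => by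
    simp only [cellIndex_eq hx]⟩, ?_, fun ν hν x hx => ?_⟩
  · exact measurable_eval_comp_of_countable P (measurable_cellIndex κ)
  · have hb : ∀ ν, ∃ M, ∀ x ∈ Set.Icc (0 : Fin d → ℝ) 1, ‖MvPolynomial.eval x (P ν)‖ ≤ M :=
      fun ν => isCompact_Icc.exists_bound_of_continuousOn
        (continuous_eval_mvPolynomial (P ν)).continuousOn
    choose M hM using hb
    refine ⟨∑ ν ∈ Fintype.piFinset fun i => Finset.range (2 ^ κ i), |M ν|, fun x hx => ?_⟩
    have hx' : x ∈ Set.Icc (0 : Fin d → ℝ) 1 :=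
      ⟨fun i => (hx i (Set.mem_univ i)).1.le, fun i => (hx i (Set.mem_univ i)).2.le⟩
    refine ((hM _ x hx').trans (le_abs_self _)).trans
      (Finset.single_le_sum (f := fun ν => |M ν|) (fun _ _ => abs_nonneg _) ?_)
    exact Fintype.mem_piFinset.2 fun i => Finset.mem_range.2 (cellIndex_lt κ hx i)
  · simp only [cellIndex_eq (dyadicCube_subset_dyadicCell κ ν hx)]
    exact (hfP ν hν x hx).symm

theorem ae_exists_mem_dyadicCube (κ : Fin d → ℕ) : ∀ᵐ x ∂(cubeMeasure d),
    ∃ ν : Fin d → ℕ, (∀ i, ν i < 2 ^ κ i) ∧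
      x ∈ dyadicCube d (fun i => (κ i : ℤ)) (fun i => (ν i : ℤ)) := by
  have h : ∀ᵐ x : Fin d → ℝ, ∀ ν : Fin d → ℕ,
      x ∈ dyadicCell κ ν → x ∈ dyadicCube d (fun i => (κ i : ℤ)) (fun i => (ν i : ℤ)) :=
    ae_all_iff.2 fun ν => (dyadicCube_ae_eq_dyadicCell κ ν).mem_iff.mono fun x hx => hx.2
  filter_upwards [ae_mem_unitCube d, ae_restrict_of_ae h] with x hx hx'
  exact ⟨cellIndex κ x, cellIndex_lt κ hx,
    hx' _ (mem_dyadicCell_cellIndex κ fun i => (hx i (Set.mem_univ i)).1.le)⟩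

/-- Restricting a multivariate polynomial to a line parallel to the `j`-th axis. -/
theorem exists_polynomial_eval_update (j : Fin d) (P : MvPolynomial (Fin d) ℝ) (x : Fin d → ℝ) :
    ∃ q : Polynomial ℝ, q.natDegree ≤ P.degreeOf j ∧
      ∀ t, MvPolynomial.eval (Function.update x j t) P = q.eval t := by
  refine ⟨∑ s ∈ P.support, Polynomial.C (P.coeff s * ∏ i ∈ Finset.univ.erase j, x i ^ s i)
    * Polynomial.X ^ s j, ?_, fun t => ?_⟩
  · refine Polynomial.natDegree_sum_le_of_forall_le _ _ fun s hs => ?_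
    exact (Polynomial.natDegree_C_mul_X_pow_le _ _).trans
      (MvPolynomial.le_degreeOf_of_mem_support j hs)
  · rw [MvPolynomial.eval_eq', Polynomial.eval_finsetSum]
    refine Finset.sum_congr rfl fun s _ => ?_
    rw [← Finset.mul_prod_erase _ _ (Finset.mem_univ j), Function.update_self]
    simp only [Polynomial.eval_mul, Polynomial.eval_C, Polynomial.eval_pow, Polynomial.eval_X]
    rw [Finset.prod_congr rfl fun i hi => by
      rw [Function.update_of_ne (Finset.ne_of_mem_erase hi)]]
    ring

theorem IsCellPoly.isDyadicPolyIn {l κ : Fin d → ℕ} {g : (Fin d → ℝ) → ℝ}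
    (hg : IsCellPoly l κ g) (j : Fin d) : IsDyadicPolyIn j (κ j) (l j) g := by
  intro x hx ν
  obtain ⟨P, hP, hgP⟩ := hg (Function.update (cellIndex κ x) j ν)
  obtain ⟨q, hq, hqP⟩ := exists_polynomial_eval_update j P x
  refine ⟨q, hq.trans (hP j), fun t ht => ?_⟩
  rw [← hqP]
  refine hgP _ fun i _ => ?_
  by_cases hi : i = j
  · subst hi; simpa using ht
  · simpa [hi] using mem_dyadicCell_cellIndex κ (fun i => (hx i (Set.mem_univ i)).1.le) i
      (Set.mem_univ i)

end Cells

noncomputable section ZeroMeans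

variable {d : ℕ}

/-- Integrating a polynomial in one variable over a bounded set yields a polynomial in the other
variables. -/
theorem exists_mvPolynomial_eval_eq_integral (j : Fin d) (P : MvPolynomial (Fin d) ℝ) {S : Set ℝ}
    {a b : ℝ} (hS : S ⊆ Set.Icc a b) :
    ∃ Q : MvPolynomial (Fin d) ℝ, (∀ i, Q.degreeOf i ≤ P.degreeOf i) ∧
      ∀ x, MvPolynomial.eval x Q = ∫ t in S, MvPolynomial.eval (Function.update x j t) P := by
  refine ⟨∑ s ∈ P.support, MvPolynomial.monomial (s.erase j) (P.coeff s * ∫ t in S, t ^ s j),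
    fun i => ?_, fun x => ?_⟩
  · rw [MvPolynomial.degreeOf_le_iff]
    intro m hm
    obtain ⟨s, hs, hms⟩ := Finset.mem_biUnion.1 (MvPolynomial.support_sum hm)
    have := Finset.mem_singleton.1 (MvPolynomial.support_monomial_subset hms)
    subst this
    refine le_trans ?_ (MvPolynomial.le_degreeOf_of_mem_support i hs)
    rw [Finsupp.erase_apply]
    split_ifs <;> simp
  · rw [map_sum]
    simp_rw [MvPolynomial.eval_eq' (Function.update x j _)]
    rw [integral_finsetSum]
    · refine Finset.sum_congr rfl fun s _ => ?_
      rw [MvPolynomial.eval_monomial, Finsupp.prod_fintype _ _ (by simp),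
        ← Finset.mul_prod_erase _ _ (Finset.mem_univ j)]
      have : ∀ t, P.coeff s * ∏ i, Function.update x j t i ^ s i
          = (P.coeff s * ∏ i ∈ Finset.univ.erase j, x i ^ s i) * t ^ s j := fun t => by
        rw [← Finset.mul_prod_erase _ _ (Finset.mem_univ j), Function.update_self,
          Finset.prod_congr rfl fun i hi => by
            rw [Function.update_of_ne (Finset.ne_of_mem_erase hi)]]
        ring
      simp_rw [this]
      rw [integral_const_mul, Finsupp.erase_same, pow_zero, one_mul,
        Finset.prod_congr rfl fun i hi => by rw [Finsupp.erase_ne (Finset.ne_of_mem_erase hi)]]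
      ring
    · intro s _
      have hc : Continuous fun t => P.coeff s * ∏ i, Function.update x j t i ^ s i := by
        refine continuous_const.mul (continuous_finsetProd _ fun i _ => Continuous.pow ?_ _)
        have hu : Continuous fun t : ℝ => Function.update x j t :=
          continuous_const.update j continuous_id
        exact (continuous_apply i).comp hu
      exact hc.integrableOn_Icc.mono_set hS

/-- `g` is polynomial on the cells of level `κ` and has there the same moments as `f`. -/
def IsCellProj (l κ : Fin d → ℕ) (f g : (Fin d → ℝ) → ℝ) : Prop :=
  IsCellPoly l κ g ∧ ∀ ν : Fin d → ℕ, (∀ i, ν i < 2 ^ κ i) → ∀ P : MvPolynomial (Fin d) ℝ,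
    degLE d l P → ∫ x in dyadicCell κ ν, g x * MvPolynomial.eval x P =
      ∫ x in dyadicCell κ ν, f x * MvPolynomial.eval x P

theorem IsProjFamily.exists_isCellProj {l : Fin d → ℕ}
    {E : (Fin d → ℕ) → ((Fin d → ℝ) → ℝ) → ((Fin d → ℝ) → ℝ)} (hE : IsProjFamily d l E)
    {f : (Fin d → ℝ) → ℝ} (hf : IntegrableOn f (unitCube d)) (κ : Fin d → ℕ) :
    ∃ g, Measurable g ∧ IsCellProj l κ f g ∧ (∀ p, MemLp g p (cubeMeasure d)) ∧
      g =ᵐ[cubeMeasure d] E κ f := by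
  obtain ⟨-, -, hpoly, horth⟩ := hE κ
  obtain ⟨g, hgm, hg, ⟨M, hM⟩, hgE⟩ := (hpoly f).exists_isCellPoly
  refine ⟨g, hgm, ⟨hg, fun ν hν P hP => ?_⟩, fun p => ?_, ?_⟩
  · rw [← setIntegral_congr_set (dyadicCube_ae_eq_dyadicCell κ ν),
      ← setIntegral_congr_set (dyadicCube_ae_eq_dyadicCell κ ν),
      ← horth f hf (fun i => (ν i : ℤ)) (fun i => ⟨Int.natCast_nonneg _, by
        simpa using (by exact_mod_cast hν i : ((ν i : ℕ) : ℤ) < 2 ^ κ i)⟩) P hP]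
    refine setIntegral_congr_fun ?_ fun x hx => ?_
    · exact MeasurableSet.univ_pi fun _ => measurableSet_Ioo
    · simp only [hgE ν hν x hx]
  · exact MemLp.of_bound hgm.aestronglyMeasurable M ((ae_mem_unitCube d).mono hM)
  · filter_upwards [ae_exists_mem_dyadicCube κ] with x ⟨ν, hν, hx⟩
    exact hgE ν hν x hx

theorem IsCellPoly.integrableOn_mul_eval {l κ ν : Fin d → ℕ} {g : (Fin d → ℝ) → ℝ}
    (hg : IsCellPoly l κ g) (hν : ∀ i, ν i < 2 ^ κ i) (P : MvPolynomial (Fin d) ℝ) :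
    IntegrableOn (fun x => g x * MvPolynomial.eval x P) (dyadicCell κ ν) := by
  obtain ⟨A, -, hA⟩ := hg ν
  refine (integrableOn_congr_fun (g := fun x => MvPolynomial.eval x A * MvPolynomial.eval x P)
    (fun x hx => by simp only [hA x hx]) (measurableSet_dyadicCell κ ν)).2 ?_
  exact (((continuous_eval_mvPolynomial A).mul
    (continuous_eval_mvPolynomial P)).continuousOn.integrableOn_compact isCompact_Icc).mono_set
      (dyadicCell_subset_Icc hν)

theorem integrableOn_mul_eval {f : (Fin d → ℝ) → ℝ} (hf : IntegrableOn f (unitCube d))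
    {κ ν : Fin d → ℕ} (hν : ∀ i, ν i < 2 ^ κ i) (P : MvPolynomial (Fin d) ℝ) :
    IntegrableOn (fun x => f x * MvPolynomial.eval x P) (dyadicCell κ ν) := by
  have hf' : IntegrableOn f (Set.Icc 0 1) := hf.congr_set_ae unitCube_ae_eq_Icc.symm
  exact (hf'.mul_continuousOn (continuous_eval_mvPolynomial P).continuousOn
    isCompact_Icc).mono_set (dyadicCell_subset_Icc hν)

theorem dyadicIco_eq_union (n ν : ℕ) :
    dyadicIco n ν = dyadicIco (n + 1) (2 * ν) ∪ dyadicIco (n + 1) (2 * ν + 1) := by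
  have h1 : ((2 * ν : ℕ) : ℝ) / 2 ^ (n + 1) = ν / 2 ^ n := by
    push_cast; rw [pow_succ]; field_simp
  have h2 : (((2 * ν + 1 : ℕ) : ℝ) + 1) / 2 ^ (n + 1) = (ν + 1) / 2 ^ n := by
    push_cast; rw [pow_succ]; field_simp; ring
  have h3 : (((2 * ν : ℕ) : ℝ) + 1) = ((2 * ν + 1 : ℕ) : ℝ) := by push_cast; ring
  rw [dyadicIco, dyadicIco, dyadicIco, h3, Set.Ico_union_Ico_eq_Ico, h1, h2]
  · gcongr; omega
  · gcongr; linarith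

theorem dyadicCell_eq_union (κ ν : Fin d → ℕ) (j : Fin d) :
    dyadicCell κ ν = dyadicCell (Function.update κ j (κ j + 1)) (Function.update ν j (2 * ν j))
      ∪ dyadicCell (Function.update κ j (κ j + 1)) (Function.update ν j (2 * ν j + 1)) := by
  have key : ∀ a : ℕ, dyadicCell (Function.update κ j (κ j + 1)) (Function.update ν j a)
      = {x | x j ∈ dyadicIco (κ j + 1) a ∧ ∀ i ≠ j, x i ∈ dyadicIco (κ i) (ν i)} := fun a => by
    ext x
    simp only [dyadicCell, Set.mem_univ_pi, Set.mem_ofPred_eq]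
    constructor
    · exact fun h => ⟨by simpa using h j, fun i hi => by simpa [hi] using h i⟩
    · rintro ⟨h1, h2⟩ i
      by_cases hi : i = j
      · subst hi; simpa using h1
      · simpa [hi] using h2 i hi
  have key' : dyadicCell κ ν
      = {x | x j ∈ dyadicIco (κ j) (ν j) ∧ ∀ i ≠ j, x i ∈ dyadicIco (κ i) (ν i)} := by
    ext x
    simp only [dyadicCell, Set.mem_univ_pi, Set.mem_ofPred_eq]
    refine ⟨fun h => ⟨h j, fun i _ => h i⟩, fun ⟨h1, h2⟩ i => ?_⟩
    by_cases hi : i = j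
    · subst hi; exact h1
    · exact h2 i hi
  rw [key, key, key', dyadicIco_eq_union (κ j)]
  ext x
  simp only [Set.mem_ofPred_eq, Set.mem_union]
  tauto

theorem disjoint_dyadicIco {n a b : ℕ} (h : a ≠ b) : Disjoint (dyadicIco n a) (dyadicIco n b) :=
  pairwiseDisjoint_dyadicIco n Set.univ (Set.mem_univ a) (Set.mem_univ b) h

theorem disjoint_dyadicCell {κ ν ν' : Fin d → ℕ} (h : ν ≠ ν') :
    Disjoint (dyadicCell κ ν) (dyadicCell κ ν') :=
  Set.disjoint_left.2 fun _ hx hx' => h ((cellIndex_eq hx).symm.trans (cellIndex_eq hx'))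

theorem update_lt_two_pow_update {κ ν : Fin d → ℕ} (hν : ∀ i, ν i < 2 ^ κ i) (j : Fin d) {n a : ℕ}
    (ha : a < 2 ^ n) (i : Fin d) : Function.update ν j a i < 2 ^ Function.update κ j n i := by
  by_cases hi : i = j
  · subst hi; simpa using ha
  · simpa [hi] using hν i

theorem IsCellProj.setIntegral_coarse {l κ ν : Fin d → ℕ} {f g : (Fin d → ℝ) → ℝ} {j : Fin d}
    (hf : IntegrableOn f (unitCube d))
    (hg : IsCellProj l (Function.update κ j (κ j + 1)) f g) (hν : ∀ i, ν i < 2 ^ κ i)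
    {P : MvPolynomial (Fin d) ℝ} (hP : degLE d l P) :
    IntegrableOn (fun x => g x * MvPolynomial.eval x P) (dyadicCell κ ν) ∧
    ∫ x in dyadicCell κ ν, g x * MvPolynomial.eval x P =
      ∫ x in dyadicCell κ ν, f x * MvPolynomial.eval x P := by
  have h1 : ∀ i, Function.update ν j (2 * ν j) i < 2 ^ Function.update κ j (κ j + 1) i :=
    update_lt_two_pow_update hν j (by have := hν j; rw [pow_succ]; omega)
  have h2 : ∀ i, Function.update ν j (2 * ν j + 1) i < 2 ^ Function.update κ j (κ j + 1) i :=
    update_lt_two_pow_update hν j (by have := hν j; rw [pow_succ]; omega)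
  have hd : Disjoint (dyadicCell (Function.update κ j (κ j + 1)) (Function.update ν j (2 * ν j)))
      (dyadicCell (Function.update κ j (κ j + 1)) (Function.update ν j (2 * ν j + 1))) :=
    disjoint_dyadicCell fun h => by simpa using congrFun h j
  rw [dyadicCell_eq_union κ ν j]
  have i1 := hg.1.integrableOn_mul_eval h1 P
  have i2 := hg.1.integrableOn_mul_eval h2 P
  refine ⟨i1.union i2, ?_⟩
  rw [setIntegral_union hd (measurableSet_dyadicCell _ _) i1 i2,
    setIntegral_union hd (measurableSet_dyadicCell _ _) (integrableOn_mul_eval hf h1 P)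
      (integrableOn_mul_eval hf h2 P), hg.2 _ h1 P hP, hg.2 _ h2 P hP]

end ZeroMeans

noncomputable section ZeroMeansMain

variable {d : ℕ}

theorem mem_dyadicCell_update_iff {κ ν : Fin d → ℕ} {j : Fin d} {x : Fin d → ℝ} {t : ℝ} :
    Function.update x j t ∈ dyadicCell κ ν ↔
      t ∈ dyadicIco (κ j) (ν j) ∧ ∀ i ≠ j, x i ∈ dyadicIco (κ i) (ν i) := by
  simp only [dyadicCell, Set.mem_univ_pi]
  refine ⟨fun h => ⟨by simpa using h j, fun i hi => by simpa [hi] using h i⟩, ?_⟩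
  rintro ⟨h1, h2⟩ i
  by_cases hi : i = j
  · subst hi; simpa using h1
  · simpa [hi] using h2 i hi

theorem eq_zero_of_ae_eq_zero_dyadicCell {κ ν : Fin d → ℕ} {H : MvPolynomial (Fin d) ℝ}
    (h : ∀ᵐ x ∂(volume.restrict (dyadicCell κ ν)), MvPolynomial.eval x H = 0) : H = 0 := by
  have hU := dyadicCube_eq κ ν
  have h' := ae_restrict_of_ae_restrict_of_subset (dyadicCube_subset_dyadicCell κ ν) h
  rw [hU] at h'
  have hopen : IsOpen (Set.univ.pi fun i =>
      Set.Ioo ((ν i : ℝ) / 2 ^ κ i) ((ν i + 1) / 2 ^ κ i)) :=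
    isOpen_set_pi Set.finite_univ fun _ _ => isOpen_Ioo
  have heq := Measure.eqOn_open_of_ae_eq (g := fun _ => (0:ℝ)) h' hopen
    (continuous_eval_mvPolynomial H).continuousOn continuousOn_const
  refine MvPolynomial.funext_set (fun i => Set.Ioo ((ν i : ℝ) / 2 ^ κ i) ((ν i + 1) / 2 ^ κ i))
    (fun i => Set.Ioo_infinite ?_) fun x hx => ?_
  · gcongr; linarith
  · rw [map_zero]; exact heq hx

/-- If the partial integrals of `g` over a cell are given by a polynomial `H`, and `g` is
orthogonal to `H` on the cell, then `H` vanishes. -/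
theorem eq_zero_of_setIntegral_mul_eval_eq_zero {κ ν : Fin d → ℕ} (hν : ∀ i, ν i < 2 ^ κ i)
    {j : Fin d} {g : (Fin d → ℝ) → ℝ} {H : MvPolynomial (Fin d) ℝ}
    (hH : ∀ x, (∀ i ≠ j, x i ∈ dyadicIco (κ i) (ν i)) →
      ∫ t in dyadicIco (κ j) (ν j), g (Function.update x j t) = MvPolynomial.eval x H)
    (hHj : ∀ x t, MvPolynomial.eval (Function.update x j t) H = MvPolynomial.eval x H)
    (hint : IntegrableOn (fun x => g x * MvPolynomial.eval x H) (dyadicCell κ ν))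
    (horth : ∫ x in dyadicCell κ ν, g x * MvPolynomial.eval x H = 0) : H = 0 := by
  have hm := measurableSet_dyadicCell κ ν
  have hint' : Integrable ((dyadicCell κ ν).indicator fun x => g x * MvPolynomial.eval x H)
      (cubeMeasure d) := by
    rw [integrable_indicator_iff hm, IntegrableOn, restrict_cubeMeasure_dyadicCell hν]
    exact hint
  have hF := integral_integral_update j hint'
  rw [integral_indicator hm, restrict_cubeMeasure_dyadicCell hν, horth] at hF
  set Q : Set (Fin d → ℝ) := {x | ∀ i ≠ j, x i ∈ dyadicIco (κ i) (ν i)} with hQ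
  have hQm : MeasurableSet Q := by
    have : Q = ⋂ i ∈ ({j}ᶜ : Set (Fin d)), (fun x => x i) ⁻¹' dyadicIco (κ i) (ν i) := by
      ext x; simp [hQ]
    rw [this]
    exact MeasurableSet.biInter (Set.to_countable _) fun i _ =>
      measurable_pi_apply i (measurableSet_dyadicIco _ _)
  have hinner : ∀ x, ∫ t in Set.Ioo (0:ℝ) 1,
      (dyadicCell κ ν).indicator (fun x => g x * MvPolynomial.eval x H) (Function.update x j t)
        = Q.indicator (fun x => MvPolynomial.eval x H ^ 2) x := fun x => by
    by_cases hx : x ∈ Q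
    · have h1 : ∀ t, (dyadicCell κ ν).indicator (fun x => g x * MvPolynomial.eval x H)
          (Function.update x j t) = (dyadicIco (κ j) (ν j)).indicator
            (fun t => g (Function.update x j t) * MvPolynomial.eval x H) t := fun t => by
        by_cases ht : t ∈ dyadicIco (κ j) (ν j)
        · rw [Set.indicator_of_mem ht, Set.indicator_of_mem (mem_dyadicCell_update_iff.2 ⟨ht, hx⟩),
            hHj]
        · rw [Set.indicator_of_notMem ht, Set.indicator_of_notMem fun h =>
            ht (mem_dyadicCell_update_iff.1 h).1]
      simp_rw [h1]
      rw [Measure.restrict_congr_set Ioo_ae_eq_Ico,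
        integral_indicator (measurableSet_dyadicIco _ _),
        Measure.restrict_restrict (measurableSet_dyadicIco _ _),
        Set.inter_eq_left.2 (dyadicIco_subset_Ico (hν j)), integral_mul_const, hH x hx,
        Set.indicator_of_mem hx, sq]
    · rw [Set.indicator_of_notMem hx]
      refine integral_eq_zero_of_ae (Filter.Eventually.of_forall fun t => ?_)
      exact Set.indicator_of_notMem (fun h => hx (mem_dyadicCell_update_iff.1 h).2) _
  simp_rw [hinner] at hF
  have hcont : Continuous fun x => MvPolynomial.eval x H ^ 2 :=
    (continuous_eval_mvPolynomial H).pow 2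
  have hae := (integral_eq_zero_iff_of_nonneg
    (fun x => Set.indicator_nonneg (fun _ _ => sq_nonneg _) x) (by
      rw [cubeMeasure_eq_restrict_Icc]
      exact Integrable.indicator (hcont.continuousOn.integrableOn_compact isCompact_Icc) hQm)).1 hF
  refine eq_zero_of_ae_eq_zero_dyadicCell (κ := κ) (ν := ν) ?_
  rw [← restrict_cubeMeasure_dyadicCell hν]
  filter_upwards [ae_restrict_of_ae hae, ae_restrict_mem hm] with x hx hxm
  rw [Set.indicator_of_mem (show x ∈ Q from fun i _ => hxm i (Set.mem_univ i))] at hx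
  simpa using hx

theorem IsCellProj.hasZeroMeansIn_sub {l κ : Fin d → ℕ} {f g g' : (Fin d → ℝ) → ℝ} {j : Fin d}
    (hf : IntegrableOn f (unitCube d))
    (hg : IsCellProj l (Function.update κ j (κ j + 1)) f g) (hg' : IsCellProj l κ f g') :
    HasZeroMeansIn j (κ j) (fun x => g x - g' x) := by
  intro x hx a ha
  set ν : Fin d → ℕ := Function.update (cellIndex κ x) j a with hνdef
  have hν : ∀ i, ν i < 2 ^ κ i := fun i => by
    by_cases hi : i = j
    · subst hi; simpa [hνdef] using ha
    · simpa [hνdef, hi] using cellIndex_lt κ hx i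
  have hνj : ν j = a := by simp [hνdef]
  have hxν : ∀ i ≠ j, x i ∈ dyadicIco (κ i) (ν i) := fun i hi => by
    simpa [hνdef, hi] using mem_dyadicCell_cellIndex κ (fun i => (hx i (Set.mem_univ i)).1.le) i
      (Set.mem_univ i)
  obtain ⟨A, hA, hgA⟩ := hg.1 (Function.update ν j (2 * ν j))
  obtain ⟨A', hA', hgA'⟩ := hg.1 (Function.update ν j (2 * ν j + 1))
  obtain ⟨B, hB, hgB⟩ := hg'.1 ν
  have hsub : ∀ n b, dyadicIco n b ⊆ Set.Icc ((b : ℝ) / 2 ^ n) ((b + 1) / 2 ^ n) :=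
    fun _ _ => Set.Ico_subset_Icc_self
  obtain ⟨H, hHd, hH⟩ := exists_mvPolynomial_eval_eq_integral j A (hsub (κ j + 1) (2 * ν j))
  obtain ⟨H', hHd', hH'⟩ := exists_mvPolynomial_eval_eq_integral j A' (hsub (κ j + 1) (2 * ν j + 1))
  obtain ⟨K, hKd, hK⟩ := exists_mvPolynomial_eval_eq_integral j B (hsub (κ j) (ν j))
  have hcont : ∀ (P : MvPolynomial (Fin d) ℝ) (y : Fin d → ℝ),
      Continuous fun t => MvPolynomial.eval (Function.update y j t) P := fun P y =>
    (continuous_eval_mvPolynomial P).comp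
      ((continuous_const : Continuous fun _ : ℝ => y).update j continuous_id)
  have hpart : ∀ {P : MvPolynomial (Fin d) ℝ} {y : Fin d → ℝ} {u : (Fin d → ℝ) → ℝ} {n b : ℕ},
      (∀ t ∈ dyadicIco n b,
        u (Function.update y j t) = MvPolynomial.eval (Function.update y j t) P) →
      IntegrableOn (fun t => u (Function.update y j t)) (dyadicIco n b) ∧
      ∫ t in dyadicIco n b, u (Function.update y j t)
        = ∫ t in dyadicIco n b, MvPolynomial.eval (Function.update y j t) P :=
    fun {P y u n b} h => ⟨(integrableOn_congr_fun h (measurableSet_dyadicIco _ _)).2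
      ((hcont P y).integrableOn_Icc.mono_set (hsub n b)),
      setIntegral_congr_fun (measurableSet_dyadicIco _ _) h⟩
  have hcell : ∀ b y, (∀ i ≠ j, y i ∈ dyadicIco (κ i) (ν i)) → ∀ t ∈ dyadicIco (κ j + 1) b,
      Function.update y j t
        ∈ dyadicCell (Function.update κ j (κ j + 1)) (Function.update ν j b) := by
    intro b y hy t ht
    refine mem_dyadicCell_update_iff.2 ⟨by simpa using ht, fun i hi => by simpa [hi] using hy i hi⟩
  have hmean : ∀ y, (∀ i ≠ j, y i ∈ dyadicIco (κ i) (ν i)) →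
      ∫ t in dyadicIco (κ j) (ν j), (fun x => g x - g' x) (Function.update y j t)
        = MvPolynomial.eval y (H + H' - K) := fun y hy => by
    obtain ⟨i1, e1⟩ := hpart fun t ht => hgA _ (hcell _ y hy t ht)
    obtain ⟨i2, e2⟩ := hpart fun t ht => hgA' _ (hcell _ y hy t ht)
    obtain ⟨i3, e3⟩ := hpart fun t ht => hgB _ (mem_dyadicCell_update_iff.2 ⟨ht, hy⟩)
    have hdis := disjoint_dyadicIco (n := κ j + 1) (a := 2 * ν j) (b := 2 * ν j + 1) (by omega)
    have i12 : IntegrableOn (fun t => g (Function.update y j t)) (dyadicIco (κ j) (ν j)) := by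
      rw [dyadicIco_eq_union]; exact i1.union i2
    rw [integral_sub i12 i3, map_sub, map_add, hH, hH', hK, ← e1, ← e2, ← e3]
    congr 1
    rw [dyadicIco_eq_union, setIntegral_union hdis (measurableSet_dyadicIco _ _) i1 i2]
  have hdeg : degLE d l (H + H' - K) := fun i =>
    (MvPolynomial.degreeOf_sub_le i _ _).trans (max_le ((MvPolynomial.degreeOf_add_le i _ _).trans
      (max_le ((hHd i).trans (hA i)) ((hHd' i).trans (hA' i)))) ((hKd i).trans (hB i)))
  have hconst : ∀ y t, MvPolynomial.eval (Function.update y j t) (H + H' - K)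
      = MvPolynomial.eval y (H + H' - K) := fun y t => by
    simp only [map_sub, map_add, hH, hH', hK, Function.update_idem]
  obtain ⟨hi, he⟩ := hg.setIntegral_coarse hf hν hdeg
  have hi' := hg'.1.integrableOn_mul_eval hν (H + H' - K)
  have hzero : H + H' - K = 0 := by
    refine eq_zero_of_setIntegral_mul_eval_eq_zero (g := fun x => g x - g' x) hν hmean hconst ?_ ?_
    · simp only [sub_mul]
      exact hi.sub hi'
    · simp only [sub_mul]
      rw [integral_sub hi hi', he, hg'.2 ν hν _ hdeg, sub_self]
  have := hmean x hxν
  rwa [hzero, map_zero, hνj] at this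

end ZeroMeansMain

noncomputable section Mixed

variable {d : ℕ}

/-- The mixed backward difference of a family of numbers indexed by `ℕ^d`. -/
def mixedDiff (a : (Fin d → ℕ) → ℝ) (κ : Fin d → ℕ) : ℝ :=
  ∑ S ∈ (sSet d κ).powerset, (-1 : ℝ) ^ S.card * a (fun i => κ i - if i ∈ S then 1 else 0)

theorem mixedDiff_eq_prod (y κ : Fin d → ℕ) :
    mixedDiff (fun z => if z = y then 1 else 0) κ
      = ∏ i, (-(if κ i ≠ 0 ∧ κ i - 1 = y i then (1:ℝ) else 0) + if κ i = y i then 1 else 0) := by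
  rw [Finset.prod_add, mixedDiff]
  refine Finset.sum_subset_zero_on_sdiff (Finset.powerset_mono.2 (Finset.subset_univ _))
    (fun S hS => ?_) (fun S hS => ?_)
  · rw [Finset.mem_sdiff, Finset.mem_powerset, Finset.mem_powerset] at hS
    obtain ⟨i, hi, hi'⟩ := Finset.not_subset.1 hS.2
    have h0 : κ i = 0 := by simpa [sSet] using hi'
    rw [Finset.prod_eq_zero hi (by simp [h0]), zero_mul]
  · rw [Finset.mem_powerset] at hS
    have h1 : ∏ i ∈ S, -(if κ i ≠ 0 ∧ κ i - 1 = y i then (1:ℝ) else 0)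
        = (-1) ^ S.card * ∏ i ∈ S, if κ i - (if i ∈ S then 1 else 0) = y i then (1:ℝ) else 0 := by
      rw [← Finset.prod_const, ← Finset.prod_mul_distrib]
      refine Finset.prod_congr rfl fun i hi => ?_
      have : κ i ≠ 0 := by simpa [sSet] using hS hi
      by_cases h : κ i - 1 = y i <;> simp [hi, this, h]
    have h2 : ∏ i ∈ Finset.univ \ S, (if κ i = y i then (1:ℝ) else 0)
        = ∏ i ∈ Finset.univ \ S, if κ i - (if i ∈ S then 1 else 0) = y i then (1:ℝ) else 0 := by
      refine Finset.prod_congr rfl fun i hi => ?_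
      simp [(Finset.mem_sdiff.1 hi).2]
    rw [h1, h2, mul_assoc, mul_comm (∏ i ∈ S, _), Finset.prod_sdiff (Finset.subset_univ S)]
    congr 1
    simp only [funext_iff]
    by_cases h : ∀ i, κ i - (if i ∈ S then 1 else 0) = y i
    · rw [if_pos h, Finset.prod_eq_one fun i _ => if_pos (h i)]
    · rw [if_neg h]
      push Not at h
      obtain ⟨i, hi⟩ := h
      exact (Finset.prod_eq_zero (Finset.mem_univ i) (if_neg hi)).symm

theorem sum_range_backward_diff (n y : ℕ) :
    ∑ m ∈ Finset.range (n + 1),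
      (-(if m ≠ 0 ∧ m - 1 = y then (1:ℝ) else 0) + if m = y then 1 else 0)
      = if n = y then 1 else 0 := by
  induction n with
  | zero => simp
  | succ n ih => rw [Finset.sum_range_succ, ih]; simp

theorem sum_rect_mixedDiff (a : (Fin d → ℕ) → ℝ) (k : Fin d → ℕ) :
    ∑ κ ∈ rect d k, mixedDiff a κ = a k := by
  have hdec : ∀ z ∈ rect d k, a z = ∑ y ∈ rect d k, a y * if z = y then 1 else 0 := fun z hz => by
    simp [hz]
  have hmem : ∀ {κ}, κ ∈ rect d k ↔ ∀ i, κ i ≤ k i := by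
    simp [rect, Fintype.mem_piFinset]
  have h1 : ∀ κ ∈ rect d k, mixedDiff a κ
      = ∑ y ∈ rect d k, a y * mixedDiff (fun z => if z = y then 1 else 0) κ := fun κ hκ => by
    simp only [mixedDiff, Finset.mul_sum]
    rw [Finset.sum_comm]
    refine Finset.sum_congr rfl fun S _ => ?_
    rw [hdec _ (hmem.2 fun i => (Nat.sub_le _ _).trans (hmem.1 hκ i)), Finset.mul_sum]
    exact Finset.sum_congr rfl fun y _ => by ring
  rw [Finset.sum_congr rfl h1, Finset.sum_comm, hdec k (hmem.2 fun i => le_rfl)]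
  refine Finset.sum_congr rfl fun y _ => ?_
  rw [← Finset.mul_sum]
  congr 1
  simp_rw [mixedDiff_eq_prod]
  rw [rect, ← Finset.prod_univ_sum (fun i => Finset.range (k i + 1))
    (fun i m => -(if m ≠ 0 ∧ m - 1 = y i then (1:ℝ) else 0) + if m = y i then 1 else 0)]
  simp_rw [sum_range_backward_diff, funext_iff]
  by_cases h : ∀ i, k i = y i
  · rw [if_pos h, Finset.prod_eq_one fun i _ => if_pos (h i)]
  · rw [if_neg h]
    push Not at h
    obtain ⟨i, hi⟩ := h
    exact Finset.prod_eq_zero (Finset.mem_univ i) (if_neg hi)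

theorem mixedDiff_eq_sum_erase (a : (Fin d → ℕ) → ℝ) {κ : Fin d → ℕ} {j : Fin d} (hj : κ j ≠ 0) :
    mixedDiff a κ = ∑ S ∈ ((sSet d κ).erase j).powerset, (-1 : ℝ) ^ S.card *
      (a (fun i => κ i - if i ∈ S then 1 else 0)
        - a (fun i => κ i - if i ∈ insert j S then 1 else 0)) := by
  have hjs : j ∈ sSet d κ := by simpa [sSet] using hj
  rw [mixedDiff, ← Finset.insert_erase hjs, Finset.sum_powerset_insert (Finset.notMem_erase _ _),
    ← Finset.sum_add_distrib, Finset.erase_insert (Finset.notMem_erase _ _)]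
  refine Finset.sum_congr rfl fun S hS => ?_
  have hjS : j ∉ S := fun h => Finset.notMem_erase j _ (Finset.mem_powerset.1 hS h)
  rw [Finset.card_insert_of_notMem hjS, pow_succ]
  ring

theorem IsDyadicPolyIn.sum {ι : Type*} {s : Finset ι} {j : Fin d} {n L : ℕ}
    {G : ι → (Fin d → ℝ) → ℝ} (h : ∀ i ∈ s, IsDyadicPolyIn j n L (G i)) :
    IsDyadicPolyIn j n L (fun x => ∑ i ∈ s, G i x) :=
  fun x hx => IsDyadicPoly.sum fun i hi => h i hi x hx

theorem IsDyadicPolyIn.const_mul {j : Fin d} {n L : ℕ} {G : (Fin d → ℝ) → ℝ}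
    (h : IsDyadicPolyIn j n L G) (c : ℝ) : IsDyadicPolyIn j n L (fun x => c * G x) :=
  fun x hx => (h x hx).const_mul c

theorem IsDyadicPolyIn.mono {j : Fin d} {n m L M : ℕ} {G : (Fin d → ℝ) → ℝ}
    (h : IsDyadicPolyIn j n L G) (hnm : n ≤ m) (hLM : L ≤ M) : IsDyadicPolyIn j m M G :=
  fun x hx ν => by
    obtain ⟨q, hq, hgq⟩ := (h x hx).mono hnm ν
    exact ⟨q, hq.trans hLM, hgq⟩

theorem IsDyadicPolyIn.sub {j : Fin d} {n L : ℕ} {G H : (Fin d → ℝ) → ℝ}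
    (hG : IsDyadicPolyIn j n L G) (hH : IsDyadicPolyIn j n L H) :
    IsDyadicPolyIn j n L (fun x => G x - H x) := fun x hx ν => by
  obtain ⟨q, hq, hgq⟩ := hG x hx ν
  obtain ⟨q', hq', hgq'⟩ := hH x hx ν
  refine ⟨q - q', (Polynomial.natDegree_sub_le_of_le hq hq').trans (max_self L).le,
    fun t ht => ?_⟩
  rw [Polynomial.eval_sub, ← hgq t ht, ← hgq' t ht]

theorem IsDyadicPoly.integrableOn {n m L ν : ℕ} {g : ℝ → ℝ} (hg : IsDyadicPoly m L g)
    (hν : ν < 2 ^ n) : IntegrableOn g (dyadicIco n ν) := by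
  have h := hg.integrable
  rw [Measure.restrict_congr_set Ioo_ae_eq_Ico] at h
  exact IntegrableOn.mono_set h (dyadicIco_subset_Ico hν)

theorem HasZeroMeansIn.sum {ι : Type*} {s : Finset ι} {j : Fin d} {n m L : ℕ}
    {G : ι → (Fin d → ℝ) → ℝ} (h : ∀ i ∈ s, HasZeroMeansIn j n (G i))
    (hp : ∀ i ∈ s, IsDyadicPolyIn j m L (G i)) :
    HasZeroMeansIn j n (fun x => ∑ i ∈ s, G i x) := fun x hx ν hν => by
  rw [integral_finsetSum s fun i hi => (hp i hi x hx).integrableOn hν]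
  exact Finset.sum_eq_zero fun i hi => h i hi x hx ν hν

theorem HasZeroMeansIn.const_mul {j : Fin d} {n : ℕ} {G : (Fin d → ℝ) → ℝ}
    (h : HasZeroMeansIn j n G) (c : ℝ) : HasZeroMeansIn j n (fun x => c * G x) :=
  fun x hx ν hν => by
  rw [integral_const_mul, h x hx ν hν, mul_zero]

theorem isDyadicPolyIn_mixedDiff {L : ℕ} {g : (Fin d → ℕ) → (Fin d → ℝ) → ℝ} {j : Fin d}
    (hg : ∀ κ, IsDyadicPolyIn j (κ j) L (g κ)) (κ : Fin d → ℕ) :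
    IsDyadicPolyIn j (κ j) L (fun x => mixedDiff (fun z => g z x) κ) :=
  IsDyadicPolyIn.sum fun _ _ => ((hg _).mono (Nat.sub_le _ _) le_rfl).const_mul _

theorem hasZeroMeansIn_mixedDiff {L n : ℕ} {g : (Fin d → ℕ) → (Fin d → ℝ) → ℝ} {j : Fin d}
    (hg : ∀ κ, IsDyadicPolyIn j (κ j) L (g κ))
    (hz : ∀ κ, HasZeroMeansIn j (κ j) (fun x => g (Function.update κ j (κ j + 1)) x - g κ x))
    {κ : Fin d → ℕ} (hκ : κ j = n + 1) :
    HasZeroMeansIn j n (fun x => mixedDiff (fun z => g z x) κ) := by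
  have hj : κ j ≠ 0 := by omega
  simp_rw [mixedDiff_eq_sum_erase _ hj]
  refine HasZeroMeansIn.sum (m := κ j) (L := L) (fun S hS => ?_) fun S hS => ?_
  · have hjS : j ∉ S := fun h => Finset.notMem_erase j _ (Finset.mem_powerset.1 hS h)
    refine HasZeroMeansIn.const_mul ?_ _
    have h := hz fun i => κ i - if i ∈ insert j S then 1 else 0
    have e1 : κ j - (if j ∈ insert j S then 1 else 0) = n := by simp [hκ]
    have e2 : Function.update (fun i => κ i - if i ∈ insert j S then 1 else 0) j (n + 1)
        = fun i => κ i - if i ∈ S then 1 else 0 := by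
      funext i
      by_cases hi : i = j
      · subst hi; simp [hjS, hκ]
      · simp [hi]
    simp only [e1] at h
    rwa [e2] at h
  · refine IsDyadicPolyIn.const_mul (.sub ?_ ?_) _
    · exact (hg fun i => κ i - if i ∈ S then 1 else 0).mono (Nat.sub_le _ _) le_rfl
    · exact (hg fun i => κ i - if i ∈ insert j S then 1 else 0).mono (Nat.sub_le _ _) le_rfl

end Mixed

noncomputable section Iteration

variable {d : ℕ}

/-- The multi-indices that agree with `κ₀` outside `T` and are bounded by `k` on `T`. -/
def rectOn (k : Fin d → ℕ) (T : Finset (Fin d)) (κ₀ : Fin d → ℕ) : Finset (Fin d → ℕ) :=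
  Fintype.piFinset fun i => if i ∈ T then Finset.range (k i + 1) else {κ₀ i}

theorem mem_rectOn {k : Fin d → ℕ} {T : Finset (Fin d)} {κ₀ κ : Fin d → ℕ} :
    κ ∈ rectOn k T κ₀ ↔ ∀ i, if i ∈ T then κ i ≤ k i else κ i = κ₀ i := by
  rw [rectOn, Fintype.mem_piFinset]
  refine forall_congr' fun i => ?_
  split_ifs <;> simp

theorem sum_rectOn_insert {M : Type*} [AddCommMonoid M] (k : Fin d → ℕ) {T : Finset (Fin d)}
    {j : Fin d} (hj : j ∉ T) (κ₀ : Fin d → ℕ) (F : (Fin d → ℕ) → M) :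
    ∑ κ ∈ rectOn k (insert j T) κ₀, F κ
      = ∑ n ∈ Finset.range (k j + 1), ∑ κ ∈ rectOn k T (Function.update κ₀ j n), F κ := by
  have hmaps : ∀ κ ∈ rectOn k (insert j T) κ₀, κ j ∈ Finset.range (k j + 1) := fun κ hκ => by
    simpa [Nat.lt_succ_iff] using mem_rectOn.1 hκ j
  rw [← Finset.sum_fiberwise_of_maps_to hmaps]
  refine Finset.sum_congr rfl fun n hn => Finset.sum_congr ?_ fun _ _ => rfl
  have hn' : n ≤ k j := Nat.lt_succ_iff.1 (Finset.mem_range.1 hn)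
  ext κ
  rw [Finset.mem_filter, mem_rectOn, mem_rectOn]
  constructor
  · rintro ⟨h, rfl⟩ i
    by_cases hi : i = j
    · subst hi; simp [hj]
    · simpa [hi] using h i
  · intro h
    have hκj : κ j = n := by simpa [hj] using h j
    refine ⟨fun i => ?_, hκj⟩
    by_cases hi : i = j
    · subst hi; simpa [hκj] using hn'
    · simpa [hi] using h i

theorem exists_eLpNorm_sum_rect_le (L : ℕ) {p : ℝ} (hp : 1 < p) (d : ℕ) :
    ∃ C : ℝ, 0 ≤ C ∧ ∀ F : (Fin d → ℕ) → (Fin d → ℝ) → ℝ, (∀ κ, Measurable (F κ)) →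
      (∀ κ, MemLp (F κ) (ENNReal.ofReal p) (cubeMeasure d)) →
      (∀ κ j, IsDyadicPolyIn j (κ j) L (F κ)) →
      (∀ κ j n, κ j = n + 1 → HasZeroMeansIn j n (F κ)) → ∀ k : Fin d → ℕ,
      eLpNorm (∑ κ ∈ rect d k, F κ) (ENNReal.ofReal p) (cubeMeasure d) ≤
        ENNReal.ofReal C * (∑ κ ∈ rect d k,
          eLpNorm (F κ) (ENNReal.ofReal p) (cubeMeasure d) ^ min 2 p) ^ (1 / min 2 p) := by
  obtain ⟨C, hC, hstep⟩ := exists_eLpNorm_sum_le_of_isDyadicPolyIn L hp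
  refine ⟨C ^ d, by positivity, fun F hFm hF hpoly hz k => ?_⟩
  have hr : 0 < min 2 p := lt_min two_pos (zero_lt_one.trans hp)
  set r := min 2 p with hrdef
  have key : ∀ (T : Finset (Fin d)) (κ₀ : Fin d → ℕ),
      eLpNorm (∑ κ ∈ rectOn k T κ₀, F κ) (ENNReal.ofReal p) (cubeMeasure d) ≤
        ENNReal.ofReal C ^ T.card * (∑ κ ∈ rectOn k T κ₀,
          eLpNorm (F κ) (ENNReal.ofReal p) (cubeMeasure d) ^ r) ^ (1 / r) := by
    intro T
    induction T using Finset.induction_on with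
    | empty =>
      intro κ₀
      have : rectOn k ∅ κ₀ = {κ₀} := by
        ext κ; simp [mem_rectOn, funext_iff]
      rw [this, Finset.sum_singleton, Finset.sum_singleton, ← ENNReal.rpow_mul,
        mul_one_div_cancel hr.ne', ENNReal.rpow_one]
      simp
    | insert j T hj ih =>
      intro κ₀
      rw [sum_rectOn_insert k hj, sum_rectOn_insert k hj, Finset.card_insert_of_notMem hj]
      have hlev : ∀ n, ∀ κ ∈ rectOn k T (Function.update κ₀ j n), κ j = n := fun n κ hκ => by
        simpa [hj] using mem_rectOn.1 hκ j
      refine (hstep j (fun n => ∑ κ ∈ rectOn k T (Function.update κ₀ j n), F κ)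
        (fun n => by
          simpa only [Finset.sum_fn] using Finset.measurable_sum _ fun κ _ => hFm κ)
        (fun n => memLp_finsetSum' _ fun κ _ => hF κ) (fun n => ?_) (fun n => ?_)
        (k j + 1)).trans ?_
      · convert IsDyadicPolyIn.sum (s := rectOn k T (Function.update κ₀ j n)) (G := F)
          fun κ hκ => ?_ using 1
        · ext x; simp
        · simpa [hlev n κ hκ] using hpoly κ j
      · convert HasZeroMeansIn.sum (s := rectOn k T (Function.update κ₀ j (n + 1))) (G := F)
          (m := n + 1) (L := L) (fun κ hκ => ?_) fun κ hκ => ?_ using 1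
        · ext x; simp
        · exact hz κ j n (hlev _ κ hκ)
        · simpa [hlev _ κ hκ] using hpoly κ j
      · rw [pow_succ, mul_comm _ (ENNReal.ofReal C), mul_assoc]
        gcongr
        calc _ ≤ (∑ n ∈ Finset.range (k j + 1), (ENNReal.ofReal C ^ T.card *
              (∑ κ ∈ rectOn k T (Function.update κ₀ j n),
                eLpNorm (F κ) (ENNReal.ofReal p) (cubeMeasure d) ^ r) ^ (1 / r)) ^ r) ^
                  (1 / r) := by
              gcongr with n hn
              exact ih _
          _ = _ := by
              simp_rw [ENNReal.mul_rpow_of_nonneg _ _ hr.le, ← ENNReal.rpow_mul,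
                one_div_mul_cancel hr.ne', ENNReal.rpow_one]
              rw [← Finset.mul_sum, ENNReal.mul_rpow_of_nonneg _ _ (by positivity),
                ← ENNReal.rpow_mul, mul_one_div_cancel hr.ne', ENNReal.rpow_one]
  have hrect : rectOn k Finset.univ k = rect d k := by simp [rectOn, rect]
  have := key Finset.univ k
  rwa [hrect, Finset.card_univ, Fintype.card_fin, ← ENNReal.ofReal_pow hC] at this

end Iteration

/-- Inequalities (2.2.45)/(2.2.46).  Let `d ∈ ℕ`, `l ∈ ℤ_+^d`, `1 < p < ∞`,
`p* = min(2,p)`.  There is `c = c(d,l,p) > 0` such that for every `f ∈ L₁(I^d)` and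
every `k ∈ ℤ_+^d`:
`‖E_k^{d,l} f‖_{L_p(I^d)} ≤ c (Σ_{κ ≤ k} ‖𝓔_κ^{d,l} f‖_{L_p(I^d)}^{p*})^{1/p*}`. -/
theorem stmt_16 (d : ℕ) (l : Fin d → ℕ) (p : ℝ) (hp1 : 1 < p)
    (E : (Fin d → ℕ) → ((Fin d → ℝ) → ℝ) → ((Fin d → ℝ) → ℝ))
    (hE : IsProjFamily d l E) :
    ∃ c : ℝ, 0 < c ∧
      ∀ f : (Fin d → ℝ) → ℝ, IntegrableOn f (unitCube d) →
        ∀ k : Fin d → ℕ,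
          eLpNorm (E k f) (ENNReal.ofReal p) (cubeMeasure d) ≤
            ENNReal.ofReal c *
              (∑ κ ∈ rect d k,
                eLpNorm (calE d E κ f) (ENNReal.ofReal p) (cubeMeasure d) ^ min 2 p) ^
                (1 / min 2 p) := by
  obtain ⟨C, hC, h⟩ := exists_eLpNorm_sum_rect_le (∑ j, l j) hp1 d
  refine ⟨C + 1, by positivity, fun f hf k => ?_⟩
  choose g hgm hg hgL hgE using hE.exists_isCellProj hf
  have hpoly : ∀ j κ, IsDyadicPolyIn j (κ j) (∑ j, l j) (g κ) := fun j κ =>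
    ((hg κ).1.isDyadicPolyIn j).mono le_rfl
      (Finset.single_le_sum (fun _ _ => Nat.zero_le _) (Finset.mem_univ j))
  have hmem : ∀ κ, MemLp (fun x => mixedDiff (fun z => g z x) κ) (ENNReal.ofReal p)
      (cubeMeasure d) := fun κ => memLp_finsetSum _ fun S _ => (hgL _ _).const_mul _
  have hmeas : ∀ κ, Measurable fun x => mixedDiff (fun z => g z x) κ := fun κ =>
    Finset.measurable_fun_sum _ fun S _ => (hgm _).const_mul _
  have hmain := h (fun κ x => mixedDiff (fun z => g z x) κ) hmeas hmem
    (fun κ j => isDyadicPolyIn_mixedDiff (hpoly j) κ)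
    (fun κ j n hκ => hasZeroMeansIn_mixedDiff (hpoly j)
      (fun κ' => (hg _).hasZeroMeansIn_sub hf (hg κ')) hκ) k
  have hsum : (∑ κ ∈ rect d k, fun x => mixedDiff (fun z => g z x) κ) = g k := by
    ext x
    rw [Finset.sum_apply, sum_rect_mixedDiff]
  have hcal : ∀ κ, eLpNorm (fun x => mixedDiff (fun z => g z x) κ) (ENNReal.ofReal p)
      (cubeMeasure d) = eLpNorm (calE d E κ f) (ENNReal.ofReal p) (cubeMeasure d) := fun κ => by
    refine eLpNorm_congr_ae ?_
    filter_upwards [ae_all_iff.2 hgE] with x hx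
    simp only [mixedDiff, calE, hx]
  rw [hsum, eLpNorm_congr_ae (hgE k)] at hmain
  simp only [hcal] at hmain
  refine hmain.trans ?_
  gcongr
  linarith
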